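/- arXiv:2111.02285 — 9 statements merged into one kernel-verified Lean document; each statement's English description precedes it below -/
import Mathlib

section
/- Let (λ_n)_{n≥1} be positive reals with λ_n → ∞, let (t_k)_{k≥0} be a strictly increasing sequence of reals with t_0 ≥ 0, and for each k ≥ 1 let a_k : ℕ → ℂ be such that ∑_{k=1}^∞ ∑_{n=1}^∞ |a_{k,n}| < ∞. Then the function F(s) = ∑_{k=1}^∞ (e^{−t_{k−1}s} − e^{−t_k s}) · ∑_{n=1}^∞ a_{k,n} λ_n (s + λ_n)^{-1} is holomorphic on the right half-plane ℂ⁺ = {s ∈ ℂ : Re s > 0}. -/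
open Filter Topology

lemma norm_mul_inv_add_ofReal_le {l : ℝ} (hl : 0 < l) {s : ℂ} (hs : 0 < s.re) (c : ℂ) :
    ‖c * (l : ℂ) * (s + (l : ℂ))⁻¹‖ ≤ ‖c‖ := by
  have hle : l ≤ ‖s + (l : ℂ)‖ := by
    have h := Complex.re_le_norm (s + (l : ℂ))
    simp only [Complex.add_re, Complex.ofReal_re] at h
    linarith
  rw [norm_mul, norm_mul, norm_inv, Complex.norm_real, Real.norm_of_nonneg hl.le, mul_assoc]
  refine mul_le_of_le_one_right (norm_nonneg c) ?_
  rw [← div_eq_mul_inv]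
  exact div_le_one_of_le₀ hle (norm_nonneg _)

lemma norm_exp_neg_ofReal_mul_le_one {t : ℝ} (ht : 0 ≤ t) {s : ℂ} (hs : 0 < s.re) :
    ‖Complex.exp (-(t : ℂ) * s)‖ ≤ 1 := by
  rw [Complex.norm_exp, Real.exp_le_one_iff]
  simpa using mul_nonneg ht hs.le

/-- The series `∑ₖ (e^{-t_{k-1}s} - e^{-t_k s}) Q_k(s)` is holomorphic on the right
half-plane.  (Lemma 3.3(c).) -/
theorem stmt_2 (lam : ℕ → ℝ) (hpos : ∀ n, 0 < lam n)
    (hlim : Tendsto lam atTop atTop)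
    (tm : ℕ → ℝ) (htm0 : 0 ≤ tm 0) (htm : StrictMono tm)
    (a : ℕ → ℕ → ℂ) (ha : Summable fun p : ℕ × ℕ => ‖a p.1 p.2‖) :
    DifferentiableOn ℂ
      (fun s : ℂ => ∑' k : ℕ,
        (Complex.exp (-(tm k : ℂ) * s) - Complex.exp (-(tm (k + 1) : ℂ) * s)) *
          ∑' n : ℕ, a k n * (lam n : ℂ) * (s + (lam n : ℂ))⁻¹)
      {s : ℂ | 0 < s.re} := by
  have hopen : IsOpen {s : ℂ | 0 < s.re} := isOpen_lt continuous_const Complex.continuous_re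
  have hrow (k : ℕ) : Summable fun n => ‖a k n‖ := ha.prod_factor k
  have hsum : Summable fun k => ∑' n, ‖a k n‖ := ha.prod
  have ht (k : ℕ) : 0 ≤ tm k := htm0.trans (htm.monotone k.zero_le)
  refine Complex.differentiableOn_tsum_of_summable_norm (hsum.mul_left 2) (fun k => ?_) hopen
    fun k s hs => ?_
  · refine DifferentiableOn.mul (by fun_prop) ?_
    refine Complex.differentiableOn_tsum_of_summable_norm (hrow k) (fun n s hs => ?_) hopen
      fun n s hs => norm_mul_inv_add_ofReal_le (hpos n) hs _
    have hne : s + (lam n : ℂ) ≠ 0 := fun h => by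
      have hre := congrArg Complex.re h
      simp only [Complex.add_re, Complex.ofReal_re, Complex.zero_re] at hre
      linarith [hpos n, show 0 < s.re from hs]
    exact (DifferentiableAt.const_mul (by fun_prop (disch := exact hne)) _).differentiableWithinAt
  · rw [norm_mul]
    refine mul_le_mul ?_ ?_ (norm_nonneg _) zero_le_two
    · refine (norm_sub_le _ _).trans ?_
      linarith [norm_exp_neg_ofReal_mul_le_one (ht k) hs,
        norm_exp_neg_ofReal_mul_le_one (ht (k + 1)) hs]
    · exact tsum_of_norm_bounded (hrow k).hasSum
        fun n => norm_mul_inv_add_ofReal_le (hpos n) hs _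
end

section
/- Let (λ_n)_{n≥1} be a nondecreasing sequence of positive real numbers with λ_n → ∞, and let (a_n)_{n≥1} be complex numbers with ∑_{n=1}^∞ |a_n| < ∞. Suppose that for some ε > 0 one has ∑_{n=1}^∞ a_n (1 − e^{−λ_n t}) = 0 for every t ∈ (0, ε). Then for every real number μ, the (finite) sum ∑_{n : λ_n = μ} a_n equals 0. In particular, if the λ_n are pairwise distinct, then a_n = 0 for all n. -/
open Filter Topology

lemma norm_mul_exp_neg_mul_le {l : ℝ} (hl : 0 ≤ l) (a : ℂ) {z : ℂ} (hz : 0 ≤ z.re) :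
    ‖a * Complex.exp (-(l : ℂ) * z)‖ ≤ ‖a‖ := by
  rw [norm_mul, Complex.norm_exp]
  refine mul_le_of_le_one_right (norm_nonneg _) (Real.exp_le_one_iff.2 ?_)
  simpa using mul_nonneg hl hz

/-- A Dirichlet series with absolutely summable coefficients and nonnegative exponents is
holomorphic in the right half-plane. -/
lemma differentiableOn_tsum_mul_exp {lam : ℕ → ℝ} (hpos : ∀ n, 0 ≤ lam n)
    {a : ℕ → ℂ} (ha : Summable fun n => ‖a n‖) :
    DifferentiableOn ℂ (fun z : ℂ => ∑' n, a n * Complex.exp (-(lam n : ℂ) * z))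
      {z | 0 < z.re} := by
  refine Complex.differentiableOn_tsum_of_summable_norm ha (fun n => ?_)
    (isOpen_lt continuous_const Complex.continuous_re) fun n z hz =>
      norm_mul_exp_neg_mul_le (hpos n) (a n) (le_of_lt hz)
  exact Differentiable.differentiableOn (by fun_prop)

lemma tsum_mul_exp_eq_of_eqOn_Ioo {lam : ℕ → ℝ} (hpos : ∀ n, 0 ≤ lam n)
    {a : ℕ → ℂ} (ha : Summable fun n => ‖a n‖) {ε : ℝ} (hε : 0 < ε) {S : ℂ}
    (h : ∀ t ∈ Set.Ioo (0 : ℝ) ε, ∑' n, a n * Complex.exp (-(lam n : ℂ) * (t : ℂ)) = S)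
    {t : ℝ} (ht : 0 < t) : ∑' n, a n * Complex.exp (-(lam n : ℂ) * (t : ℂ)) = S := by
  have hopen : IsOpen {z : ℂ | 0 < z.re} := isOpen_lt continuous_const Complex.continuous_re
  have hconn : IsPreconnected {z : ℂ | 0 < z.re} := (convex_halfSpace_re_gt 0).isPreconnected
  have hlim : Tendsto (fun x : ℝ => (x : ℂ)) (𝓝[≠] (ε / 2)) (𝓝[≠] ((ε / 2 : ℝ) : ℂ)) :=
    Complex.continuous_ofReal.continuousAt.continuousWithinAt.tendsto_nhdsWithin
      fun x hx => by simpa using Complex.ofReal_injective.ne hx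
  have hev : ∀ᶠ x : ℝ in 𝓝[≠] (ε / 2),
      ∑' n, a n * Complex.exp (-(lam n : ℂ) * (x : ℂ)) = S :=
    eventually_nhdsWithin_of_eventually_nhds <|
      eventually_of_mem (Ioo_mem_nhds (half_pos hε) (half_lt_self hε)) h
  exact ((differentiableOn_tsum_mul_exp hpos ha).analyticOnNhd hopen)
    |>.eqOn_of_preconnected_of_frequently_eq (g := fun _ => S) analyticOnNhd_const hconn
      (show ((ε / 2 : ℝ) : ℂ) ∈ _ by simpa using hε) (hlim.frequently hev.frequently)
      (show (t : ℂ) ∈ _ by simpa using ht)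

lemma tendsto_exp_neg_mul_ofReal {l : ℝ} (hl : 0 < l) :
    Tendsto (fun t : ℝ => Complex.exp (-(l : ℂ) * (t : ℂ))) atTop (𝓝 0) := by
  refine Complex.tendsto_exp_nhds_zero_iff.2 ?_
  simpa using tendsto_id.const_mul_atTop hl

/-- As `t → ∞`, a Dirichlet series with nonnegative exponents tends to the sum of the
coefficients whose exponent is zero. -/
lemma tendsto_tsum_mul_exp {lam : ℕ → ℝ} {a : ℕ → ℂ} (hpos : ∀ n, a n ≠ 0 → 0 ≤ lam n)
    (ha : Summable fun n => ‖a n‖) :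
    Tendsto (fun t : ℝ => ∑' n, a n * Complex.exp (-(lam n : ℂ) * (t : ℂ))) atTop
      (𝓝 (∑' n, {n | lam n = 0}.indicator a n)) := by
  refine tendsto_tsum_of_dominated_convergence ha (fun n => ?_) ?_
  · by_cases h0 : a n = 0
    · simp [Set.indicator, h0]
    rcases (hpos n h0).eq_or_lt with h | h
    · simp [Set.indicator, ← h]
    · simpa [Set.indicator, h.ne'] using (tendsto_exp_neg_mul_ofReal h).const_mul (a n)
  · filter_upwards [eventually_ge_atTop 0] with t ht n
    by_cases h0 : a n = 0
    · simp [h0]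
    · exact norm_mul_exp_neg_mul_le (hpos n h0) (a n) (z := t) (by simpa using ht)

/-- If a Dirichlet series with increasing exponents vanishes on the positive half-line, then the
coefficients belonging to each exponent sum to zero. -/
lemma tsum_indicator_eq_zero_of_tsum_mul_exp_eq_zero {lam : ℕ → ℝ} (hpos : ∀ n, 0 ≤ lam n)
    (hmono : Monotone lam) {a : ℕ → ℂ} (ha : Summable fun n => ‖a n‖)
    (h : ∀ t : ℝ, 0 < t → ∑' n, a n * Complex.exp (-(lam n : ℂ) * (t : ℂ)) = 0) (k : ℕ) :
    ∑' n, {n | lam n = lam k}.indicator a n = 0 := by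
  induction k using Nat.strong_induction_on with
  | _ k ih =>
  set s : Finset ℕ := {n ∈ Finset.range k | lam n < lam k} with hs
  have hmem : ∀ n, n ∈ s ↔ lam n < lam k := fun n => by
    simpa [hs] using fun hn => hmono.reflect_lt hn
  have hhead : ∀ t : ℝ, ∑ n ∈ s, a n * Complex.exp (-(lam n : ℂ) * (t : ℂ)) = 0 := by
    intro t
    rw [← Finset.sum_fiberwise_of_maps_to (t := s.image lam)
      fun n hn => Finset.mem_image_of_mem lam hn]
    refine Finset.sum_eq_zero fun ν hν => ?_
    obtain ⟨m, hm, rfl⟩ := Finset.mem_image.1 hν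
    have hsum : ∑ n ∈ s with lam n = lam m, a n = 0 := by
      rw [← ih m (hmono.reflect_lt ((hmem m).1 hm)),
        tsum_eq_sum (s := {n ∈ s | lam n = lam m})]
      · refine Finset.sum_congr rfl fun n hn => ?_
        simp [Set.indicator, (Finset.mem_filter.1 hn).2]
      · intro n hn
        refine Set.indicator_of_notMem (s := {n | lam n = lam m}) (fun hnm => hn ?_) a
        rw [Set.mem_ofPred_eq] at hnm
        rw [Finset.mem_filter, hmem, hnm]
        exact ⟨(hmem m).1 hm, rfl⟩
    rw [Finset.sum_congr rfl fun n hn => by rw [(Finset.mem_filter.1 hn).2],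
      ← Finset.sum_mul, hsum, zero_mul]
  set b : ℕ → ℂ := {n | lam k ≤ lam n}.indicator a with hb
  have hbs : Summable fun n => ‖b n‖ :=
    ha.of_nonneg_of_le (fun _ => norm_nonneg _) fun n => norm_indicator_le_norm_self _ _
  have htail : ∀ t : ℝ, 0 < t →
      ∑' n, b n * Complex.exp (-((lam n - lam k : ℝ) : ℂ) * (t : ℂ)) = 0 := by
    intro t ht
    have hsummable : Summable fun n => a n * Complex.exp (-(lam n : ℂ) * (t : ℂ)) :=
      ha.of_norm_bounded fun n =>
        norm_mul_exp_neg_mul_le (hpos n) (a n) (z := t) (by simpa using ht.le)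
    have hcompl := hsummable.sum_add_tsum_compl (s := s)
    rw [hhead t, h t ht, zero_add,
      tsum_subtype _ fun n => a n * Complex.exp (-(lam n : ℂ) * (t : ℂ))] at hcompl
    rw [← mul_zero (Complex.exp ((lam k : ℂ) * t)), ← hcompl, ← tsum_mul_left]
    refine tsum_congr fun n => ?_
    by_cases hn : lam k ≤ lam n
    · have hns : n ∈ ((s : Set ℕ)ᶜ) := by simpa [hmem] using hn
      rw [Set.indicator_of_mem hns, hb, Set.indicator_of_mem (by exact hn), mul_left_comm,
        ← Complex.exp_add]
      congr 2
      push_cast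
      ring
    · have hns : n ∉ ((s : Set ℕ)ᶜ) := by simpa [hmem] using hn
      rw [Set.indicator_of_notMem hns, hb, Set.indicator_of_notMem (by exact hn)]
      simp
  have hlim := tendsto_tsum_mul_exp (lam := fun n => lam n - lam k) (a := b)
    (fun n hn => sub_nonneg.2 (Set.mem_of_indicator_ne_zero (s := {n | lam k ≤ lam n}) hn)) hbs
  have heq := tendsto_nhds_unique hlim <| tendsto_const_nhds.congr' <|
    (eventually_gt_atTop 0).mono fun t ht => (htail t ht).symm
  rw [← heq]
  refine tsum_congr fun n => ?_
  rw [hb, Set.indicator_indicator]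
  congr 1
  ext m
  simp only [Set.mem_ofPred_eq, Set.mem_inter_iff, sub_eq_zero]
  exact ⟨fun hm => ⟨hm, hm.ge⟩, And.left⟩

/-- If `∑ aₙ (1 - e^{-λₙ t}) = 0` for `t ∈ (0, ε)`, then for every `μ` the sum of the
`aₙ` over `{n : λₙ = μ}` vanishes; in particular if the `λₙ` are pairwise distinct,
all `aₙ` vanish.  (Analytic core of Lemma 3.5.) -/
theorem stmt_3 (lam : ℕ → ℝ) (hpos : ∀ n, 0 < lam n)
    (hmono : Monotone lam) (hlim : Tendsto lam atTop atTop)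
    (a : ℕ → ℂ) (ha : Summable fun n => ‖a n‖)
    (ε : ℝ) (hε : 0 < ε)
    (hzero : ∀ t ∈ Set.Ioo (0 : ℝ) ε,
      ∑' n : ℕ, a n * (1 - Complex.exp (-(lam n : ℂ) * (t : ℂ))) = 0) :
    (∀ μ : ℝ, ∑' n : {n : ℕ // lam n = μ}, a n = 0) ∧
      (Function.Injective lam → ∀ n, a n = 0) := by
  have hsummable : ∀ t : ℝ, 0 < t → Summable fun n => a n * Complex.exp (-(lam n : ℂ) * (t : ℂ)) :=
    fun t ht => ha.of_norm_bounded fun n =>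
      norm_mul_exp_neg_mul_le (hpos n).le (a n) (z := t) (by simpa using ht.le)
  have hconst : ∀ t : ℝ, 0 < t →
      ∑' n, a n * Complex.exp (-(lam n : ℂ) * (t : ℂ)) = ∑' n, a n := by
    refine fun t => tsum_mul_exp_eq_of_eqOn_Ioo (fun n => (hpos n).le) ha hε fun t ht => ?_
    have h := hzero t ht
    simp only [mul_sub, mul_one] at h
    rw [ha.of_norm.tsum_sub (hsummable t ht.1), sub_eq_zero] at h
    exact h.symm
  have hS : ∑' n, a n = 0 := by
    have hlim' := tendsto_tsum_mul_exp (fun n _ => (hpos n).le) ha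
    simp only [(hpos _).ne', Set.ofPred_false, Set.indicator_empty, tsum_zero] at hlim'
    exact tendsto_nhds_unique (tendsto_const_nhds.congr' <|
      (eventually_gt_atTop 0).mono fun t ht => (hconst t ht).symm) hlim'
  have hfiber : ∀ μ : ℝ, ∑' n : {n : ℕ // lam n = μ}, a n = 0 := by
    intro μ
    by_cases hμ : ∃ k, lam k = μ
    · obtain ⟨k, rfl⟩ := hμ
      exact (tsum_subtype {n | lam n = lam k} a).trans <|
        tsum_indicator_eq_zero_of_tsum_mul_exp_eq_zero (fun n => (hpos n).le) hmono ha
          (fun t ht => (hconst t ht).trans hS) k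
    · have : IsEmpty {n : ℕ // lam n = μ} := ⟨fun n => hμ ⟨n, n.2⟩⟩
      exact tsum_empty
  refine ⟨hfiber, fun hinj k => ?_⟩
  have h := hfiber (lam k)
  rwa [tsum_eq_single (⟨k, rfl⟩ : {n : ℕ // lam n = lam k}) fun n hn =>
    (hn (Subtype.ext (hinj n.2))).elim] at h
end

section
/- Let (λ_n)_{n≥1} be a strictly increasing sequence of positive real numbers with λ_n → ∞, and let (a_n)_{n≥1} be complex numbers with ∑_{n=1}^∞ |a_n| < ∞. Suppose there exists ε > 0 such that e^{εs} · ∑_{n=1}^∞ a_n λ_n (s + λ_n)^{-1} tends to 0 as Re s → +∞ with s ranging over the right half-plane {Re s > 0}. Then a_n = 0 for every n. -/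
open Filter Topology

lemma Complex.norm_exp_sub_one_le_max_mul (z : ℂ) :
    ‖Complex.exp z - 1‖ ≤ max 1 (Real.exp z.re) * ‖z‖ := by
  have h := (convex_halfSpace_re_le (max 0 z.re)).norm_image_sub_le_of_norm_deriv_le
    (f := Complex.exp) (C := max 1 (Real.exp z.re)) (x := 0) (y := z)
    (fun x _ => Complex.differentiableAt_exp) (fun x hx => ?_) (by simp) (by simp)
  · simpa using h
  · rw [Complex.deriv_exp, Complex.norm_exp]
    rcases le_max_iff.1 (show x.re ≤ max 0 z.re from hx) with h | h
    · exact le_max_of_le_left (Real.exp_le_one_iff.2 h)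
    · exact le_max_of_le_right (Real.exp_le_exp.2 h)

/-- The entire function `s ↦ l (e^{εs} - e^{-εl}) / (s + l)`. -/
noncomputable def expQuotient (ε l : ℝ) (s : ℂ) : ℂ :=
  l * ε * Complex.exp (-(ε * l)) * dslope Complex.exp 0 (ε * (s + l))

lemma differentiable_expQuotient (ε l : ℝ) : Differentiable ℂ (expQuotient ε l) := by
  have h : Differentiable ℂ (dslope Complex.exp 0) := by
    rw [← differentiableOn_univ, Complex.differentiableOn_dslope univ_mem]
    exact Complex.differentiable_exp.differentiableOn
  unfold expQuotient
  exact (h.comp (by fun_prop : Differentiable ℂ fun s : ℂ => (ε : ℂ) * (s + l))).const_mul _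

lemma expQuotient_eq {ε l : ℝ} (hε : ε ≠ 0) {s : ℂ} (hs : s + l ≠ 0) :
    expQuotient ε l s =
      l * (Complex.exp (ε * s) - Complex.exp (-(ε * l))) * (s + l)⁻¹ := by
  have hε' : (ε : ℂ) ≠ 0 := by exact_mod_cast hε
  have h : Complex.exp (ε * s) = Complex.exp (-(ε * l)) * Complex.exp (ε * (s + l)) := by
    rw [← Complex.exp_add]; ring_nf
  rw [expQuotient, dslope_of_ne _ (mul_ne_zero hε' hs), slope_def_field, h, Complex.exp_zero]
  field_simp
  rw [sub_zero]
  ring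

lemma norm_dslope_exp_zero_le (z : ℂ) :
    ‖dslope Complex.exp 0 z‖ ≤ max 1 (Real.exp z.re) := by
  rcases eq_or_ne z 0 with rfl | hz
  · simp
  · rw [dslope_of_ne _ hz, slope_def_field, norm_div, sub_zero, Complex.exp_zero,
      div_le_iff₀ (norm_pos_iff.2 hz)]
    exact Complex.norm_exp_sub_one_le_max_mul z

lemma norm_expQuotient_le {ε l : ℝ} (hε : 0 < ε) (hl : 0 < l) (s : ℂ) :
    ‖expQuotient ε l s‖ ≤ 4 * max 1 (Real.exp (ε * s.re)) := by
  rcases le_or_gt (-(l / 2)) s.re with h | h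
  · have hre : l / 2 ≤ (s + l).re := by simp; linarith
    have hn : l / 2 ≤ ‖s + l‖ := hre.trans (Complex.re_le_norm _)
    have h0 : s + l ≠ 0 := norm_pos_iff.1 (by linarith)
    have h1 : ‖Complex.exp (ε * s) - Complex.exp (-(ε * l))‖
        ≤ 2 * max 1 (Real.exp (ε * s.re)) := by
      refine (norm_sub_le _ _).trans ?_
      have e1 : ‖Complex.exp (ε * s)‖ = Real.exp (ε * s.re) := by simp [Complex.norm_exp]
      have e2 : ‖Complex.exp (-(ε * l))‖ ≤ 1 := by
        simp [Complex.norm_exp]; positivity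
      have := le_max_left 1 (Real.exp (ε * s.re))
      have := le_max_right 1 (Real.exp (ε * s.re))
      linarith
    rw [expQuotient_eq hε.ne' h0, norm_mul, norm_mul, norm_inv, Complex.norm_real,
      Real.norm_of_nonneg hl.le, ← div_eq_mul_inv, div_le_iff₀ (by linarith)]
    have hM : 0 ≤ max 1 (Real.exp (ε * s.re)) := by positivity
    nlinarith [mul_le_mul_of_nonneg_left h1 hl.le, mul_le_mul_of_nonneg_left hn hM]
  · have h1 : ‖dslope Complex.exp 0 (ε * (s + l))‖ ≤ Real.exp (ε * l / 2) := by
      refine (norm_dslope_exp_zero_le _).trans (max_le ?_ ?_)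
      · exact Real.one_le_exp (by positivity)
      · rw [Real.exp_le_exp]
        simp
        nlinarith
    have h2 : ε * l / 2 * Real.exp (-(ε * l / 2)) ≤ 1 := by
      rw [Real.exp_neg, ← div_eq_mul_inv, div_le_one (Real.exp_pos _)]
      linarith [Real.add_one_le_exp (ε * l / 2)]
    have e2 : ‖Complex.exp (-(ε * l))‖ = Real.exp (-(ε * l)) := by simp [Complex.norm_exp]
    have e3 : Real.exp (-(ε * l)) * Real.exp (ε * l / 2) = Real.exp (-(ε * l / 2)) := by
      rw [← Real.exp_add]; ring_nf
    rw [expQuotient, norm_mul, norm_mul, norm_mul, e2, Complex.norm_real, Complex.norm_real,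
      Real.norm_of_nonneg hl.le, Real.norm_of_nonneg hε.le]
    calc _ ≤ l * ε * Real.exp (-(ε * l)) * Real.exp (ε * l / 2) := by gcongr
      _ = 2 * (ε * l / 2 * Real.exp (-(ε * l / 2))) := by rw [mul_assoc, e3]; ring
      _ ≤ 4 * max 1 (Real.exp (ε * s.re)) := by
        linarith [le_max_left 1 (Real.exp (ε * s.re))]

lemma norm_ofReal_mul_inv_add_le_one {l : ℝ} (hl : 0 < l) {s : ℂ} (hs : 0 ≤ s.re) :
    ‖(l : ℂ) * (s + l)⁻¹‖ ≤ 1 := by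
  have hn : l ≤ ‖s + l‖ := by
    refine le_trans ?_ (Complex.re_le_norm _)
    simpa using hs
  rw [norm_mul, norm_inv, Complex.norm_real, Real.norm_of_nonneg hl.le, ← div_eq_mul_inv,
    div_le_one (hl.trans_le hn)]
  exact hn

lemma norm_exp_neg_ofReal_mul_le_one_s4 {ε l : ℝ} (hε : 0 ≤ ε) (hl : 0 ≤ l) :
    ‖Complex.exp (-(ε * l))‖ ≤ 1 := by
  simp [Complex.norm_exp]; positivity

lemma exp_mul_tsum_eq {lam : ℕ → ℝ} (hpos : ∀ n, 0 < lam n)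
    {a : ℕ → ℂ} (ha : Summable fun n => ‖a n‖) {ε : ℝ} (hε : 0 < ε)
    (hlim0 : Tendsto
      (fun s : ℂ => Complex.exp ((ε : ℂ) * s) *
        ∑' n : ℕ, a n * (lam n : ℂ) * (s + (lam n : ℂ))⁻¹)
      (Filter.comap Complex.re Filter.atTop) (nhds 0)) {s : ℂ} (hs : 0 ≤ s.re) :
    Complex.exp (ε * s) * ∑' n, a n * lam n * (s + lam n)⁻¹ =
      ∑' n, a n * lam n * (s + lam n)⁻¹ * Complex.exp (-(ε * lam n)) := by
  set A := ∑' n, ‖a n‖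
  have hb1 : ∀ s : ℂ, 0 ≤ s.re → ∀ n, ‖a n * lam n * (s + lam n)⁻¹‖ ≤ ‖a n‖ := by
    intro s hs n
    rw [mul_assoc, norm_mul]
    exact mul_le_of_le_one_right (norm_nonneg _) (norm_ofReal_mul_inv_add_le_one (hpos n) hs)
  have hb2 : ∀ s : ℂ, 0 ≤ s.re → ∀ n,
      ‖a n * lam n * (s + lam n)⁻¹ * Complex.exp (-(ε * lam n))‖ ≤ ‖a n‖ := by
    intro s hs n
    rw [norm_mul]
    exact (mul_le_of_le_one_right (norm_nonneg _)
      (norm_exp_neg_ofReal_mul_le_one_s4 hε.le (hpos n).le)).trans (hb1 s hs n)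
  set g : ℂ → ℂ := fun s => ∑' n, a n * expQuotient ε (lam n) s with hg
  have hgb : ∀ s n, ‖a n * expQuotient ε (lam n) s‖
      ≤ ‖a n‖ * (4 * max 1 (Real.exp (ε * s.re))) := by
    intro s n
    rw [norm_mul]
    gcongr
    exact norm_expQuotient_le hε (hpos n) s
  have hgeq : ∀ s : ℂ, 0 ≤ s.re → g s =
      Complex.exp (ε * s) * ∑' n, a n * lam n * (s + lam n)⁻¹ -
      ∑' n, a n * lam n * (s + lam n)⁻¹ * Complex.exp (-(ε * lam n)) := by
    intro s hs
    rw [← tsum_mul_left, ← Summable.tsum_sub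
      ((Summable.of_norm_bounded ha (hb1 s hs)).mul_left _)
      (Summable.of_norm_bounded ha (hb2 s hs))]
    refine tsum_congr fun n => ?_
    have h0 : s + lam n ≠ 0 := by
      intro h
      have := congrArg Complex.re h
      simp at this
      linarith [hpos n]
    rw [expQuotient_eq hε.ne' h0]
    ring
  have hgd : Differentiable ℂ g := by
    intro z
    have hU : IsOpen {w : ℂ | w.re < z.re + 1} := isOpen_lt Complex.continuous_re continuous_const
    refine (Complex.differentiableOn_tsum_of_summable_norm
      (u := fun n => ‖a n‖ * (4 * max 1 (Real.exp (ε * (z.re + 1))))) (ha.mul_right _)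
      (fun n => ((differentiable_expQuotient ε (lam n)).const_mul _).differentiableOn) hU
      (fun n w hw => (hgb w n).trans ?_)).differentiableAt (hU.mem_nhds (by simp))
    have : w.re ≤ z.re + 1 := le_of_lt hw
    gcongr
  obtain ⟨R, hR0, hR⟩ : ∃ R : ℝ, 0 ≤ R ∧ ∀ s : ℂ, R ≤ s.re →
      ‖Complex.exp (ε * s) * ∑' n, a n * lam n * (s + lam n)⁻¹‖ ≤ 1 := by
    have h := hlim0.norm.eventually (ge_mem_nhds (show ‖(0 : ℂ)‖ < 1 by simp))
    rw [eventually_comap] at h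
    obtain ⟨R, hR⟩ := eventually_atTop.1 h
    exact ⟨max R 0, le_max_right _ _, fun s hs => hR s.re ((le_max_left _ _).trans hs) s rfl⟩
  have hbdd : Bornology.IsBounded (Set.range g) := by
    refine isBounded_iff_forall_norm_le.2 ⟨max (1 + A) (A * (4 * max 1 (Real.exp (ε * R)))), ?_⟩
    rintro _ ⟨s, rfl⟩
    rcases le_total R s.re with h | h
    · refine le_max_of_le_left ?_
      rw [hgeq s (hR0.trans h)]
      exact (norm_sub_le _ _).trans (add_le_add (hR s h)
        (tsum_of_norm_bounded ha.hasSum (hb2 s (hR0.trans h))))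
    · refine le_max_of_le_right ((tsum_of_norm_bounded (ha.mul_right _).hasSum (hgb s)).trans ?_)
      rw [tsum_mul_right]
      gcongr
  have hre : Tendsto (fun x : ℝ => (x : ℂ)) atTop (comap Complex.re atTop) := by
    rw [tendsto_comap_iff]
    exact tendsto_id
  have hlimg : Tendsto (fun x : ℝ => g x) atTop (𝓝 0) := by
    have h2 : Tendsto (fun x : ℝ => ∑' n, a n * lam n * ((x : ℂ) + lam n)⁻¹ *
        Complex.exp (-(ε * lam n))) atTop (𝓝 (∑' _ : ℕ, 0)) := by
      refine tendsto_tsum_of_dominated_convergence ha (fun n => ?_) ?_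
      · have h : Tendsto (fun x : ℝ => ((x : ℂ) + lam n)⁻¹) atTop (𝓝 0) := by
          have := (tendsto_inv_atTop_zero.comp
            (tendsto_atTop_add_const_right atTop (lam n) tendsto_id)).ofReal
          simpa [Function.comp_def] using this
        simpa using (h.const_mul (a n * lam n)).mul_const (Complex.exp (-(ε * lam n)))
      · filter_upwards [eventually_ge_atTop 0] with x hx n using hb2 x (by simpa using hx) n
    have h3 := (hlim0.comp hre).sub h2
    rw [tsum_zero, sub_zero] at h3
    refine h3.congr' ?_
    filter_upwards [eventually_ge_atTop 0] with x hx using (hgeq x (by simpa using hx)).symm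
  have hconst : g s = 0 := by
    refine tendsto_nhds_unique ?_ hlimg
    exact tendsto_const_nhds.congr fun x => hgd.apply_eq_apply_of_bounded hbdd s x
  rw [hgeq s hs] at hconst
  exact sub_eq_zero.1 hconst

lemma tsum_exp_eq_of_eqOn_Ioc {lam : ℕ → ℝ} (hpos : ∀ n, 0 ≤ lam n) {c : ℕ → ℂ}
    (hc : Summable fun n => ‖c n‖) {h : ℂ → ℂ} (hh : Differentiable ℂ h) {ε : ℝ} (hε : 0 < ε)
    (heq : ∀ t : ℝ, 0 < t → t ≤ ε → ∑' n, c n * Complex.exp (-(t * lam n)) = h t)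
    {t : ℝ} (ht : 0 < t) : ∑' n, c n * Complex.exp (-(t * lam n)) = h t := by
  have hU : IsOpen {z : ℂ | 0 < z.re} := isOpen_lt continuous_const Complex.continuous_re
  have hF : DifferentiableOn ℂ (fun z : ℂ => ∑' n, c n * Complex.exp (-(z * lam n)))
      {z : ℂ | 0 < z.re} := by
    refine Complex.differentiableOn_tsum_of_summable_norm hc (fun n => by fun_prop) hU ?_
    intro n z hz
    have hz : 0 < z.re := hz
    rw [norm_mul]
    refine mul_le_of_le_one_right (norm_nonneg _) ?_
    simp only [Complex.norm_exp, Real.exp_le_one_iff]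
    simp
    exact mul_nonneg hz.le (hpos n)
  have hfreq : ∃ᶠ z in 𝓝[≠] ((ε / 2 : ℝ) : ℂ),
      ∑' n, c n * Complex.exp (-(z * lam n)) = h z := by
    have hT : Tendsto (fun x : ℝ => (x : ℂ)) (𝓝[≠] (ε / 2)) (𝓝[≠] ((ε / 2 : ℝ) : ℂ)) :=
      Complex.continuous_ofReal.continuousAt.continuousWithinAt.tendsto_nhdsWithin
        (fun x hx => by simpa only [Set.mem_compl_iff, Set.mem_singleton_iff,
          Complex.ofReal_inj] using hx)
    refine hT.frequently (Eventually.frequently ?_)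
    filter_upwards [mem_nhdsWithin_of_mem_nhds
      (Ioo_mem_nhds (show 0 < ε / 2 by linarith) (show ε / 2 < ε by linarith))] with x hx
    exact heq x hx.1 hx.2.le
  exact (hF.analyticOnNhd hU).eqOn_of_preconnected_of_frequently_eq
    (hh.differentiableOn.analyticOnNhd hU) (convex_halfSpace_re_gt 0).isPreconnected
    (show 0 < ((ε / 2 : ℝ) : ℂ).re by simpa using hε) hfreq
    (show 0 < ((t : ℝ) : ℂ).re by simpa using ht)

lemma eq_zero_of_tsum_exp_eq_zero {lam : ℕ → ℝ} (hmono : StrictMono lam) {c : ℕ → ℂ}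
    (hc : Summable fun n => ‖c n‖)
    (h : ∀ t : ℝ, 0 < t → ∑' n, c n * Complex.exp (-(t * lam n)) = 0) (k : ℕ) : c k = 0 := by
  induction k using Nat.strong_induction_on with
  | _ k ih =>
  have hlim : Tendsto (fun t : ℝ => ∑' n, c n * Complex.exp (-(t * (lam n - lam k : ℝ)))) atTop
      (𝓝 (∑' n, if n = k then c k else 0)) := by
    refine tendsto_tsum_of_dominated_convergence hc (fun n => ?_) ?_
    · rcases lt_trichotomy n k with hn | rfl | hn
      · simp [ih n hn, hn.ne]
      · simp
      · rw [if_neg hn.ne']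
        have hd : 0 < lam n - lam k := sub_pos.2 (hmono hn)
        have h1 := (Real.tendsto_exp_neg_atTop_nhds_zero.comp
          (tendsto_id.atTop_mul_const hd)).ofReal.const_mul (c n)
        simpa [Function.comp_def] using h1
    · filter_upwards [eventually_ge_atTop 0] with t ht n
      rcases lt_or_ge n k with hn | hn
      · simp [ih n hn]
      · rw [norm_mul]
        exact mul_le_of_le_one_right (norm_nonneg _)
          (norm_exp_neg_ofReal_mul_le_one_s4 ht (sub_nonneg.2 (hmono.monotone hn)))
  rw [tsum_ite_eq] at hlim
  refine tendsto_nhds_unique hlim (tendsto_const_nhds.congr' ?_)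
  filter_upwards [eventually_gt_atTop 0] with t ht
  have hshift : ∀ n, c n * Complex.exp (-(t * (lam n - lam k : ℝ))) =
      Complex.exp (t * lam k) * (c n * Complex.exp (-(t * lam n))) := by
    intro n
    rw [mul_left_comm, ← Complex.exp_add]
    push_cast
    ring_nf
  rw [tsum_congr hshift, tsum_mul_left, h t ht, mul_zero]

/-- If `e^{εs} ∑ aₙ λₙ (s+λₙ)⁻¹ → 0` as `Re s → ∞`, then all `aₙ` vanish.
(Analytic core of Lemma 3.6.) -/
theorem stmt_4 (lam : ℕ → ℝ) (hpos : ∀ n, 0 < lam n)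
    (hmono : StrictMono lam) (hlim : Tendsto lam atTop atTop)
    (a : ℕ → ℂ) (ha : Summable fun n => ‖a n‖)
    (ε : ℝ) (hε : 0 < ε)
    (hlim0 : Tendsto
      (fun s : ℂ => Complex.exp ((ε : ℂ) * s) *
        ∑' n : ℕ, a n * (lam n : ℂ) * (s + (lam n : ℂ))⁻¹)
      (Filter.comap Complex.re Filter.atTop) (nhds 0)) :
    ∀ n, a n = 0 := by
  have hlim' : ∀ t : ℝ, t ≤ ε → Tendsto
      (fun s : ℂ => Complex.exp ((t : ℂ) * s) *
        ∑' n : ℕ, a n * (lam n : ℂ) * (s + (lam n : ℂ))⁻¹)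
      (Filter.comap Complex.re Filter.atTop) (nhds 0) := by
    intro t ht
    refine squeeze_zero_norm' ?_ (tendsto_zero_iff_norm_tendsto_zero.1 hlim0)
    filter_upwards [preimage_mem_comap (Ici_mem_atTop (0 : ℝ))] with s hs
    have hs : 0 ≤ s.re := hs
    rw [norm_mul, norm_mul]
    gcongr
    simp only [Complex.norm_exp, Real.exp_le_exp]
    simp
    gcongr
  set c : ℕ → ℂ := fun n => a n * lam n * ((1 : ℂ) + lam n)⁻¹ with hcdef
  set q : ℂ := ∑' n, c n
  have hc : Summable fun n => ‖c n‖ := by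
    refine Summable.of_nonneg_of_le (fun n => norm_nonneg _) (fun n => ?_) ha
    simp only [hcdef]
    rw [mul_assoc, norm_mul]
    exact mul_le_of_le_one_right (norm_nonneg _)
      (norm_ofReal_mul_inv_add_le_one (hpos n) (by simp))
  have hall : ∀ t : ℝ, 0 < t →
      ∑' n, c n * Complex.exp (-(t * lam n)) = Complex.exp t * q := by
    intro t ht
    refine tsum_exp_eq_of_eqOn_Ioc (h := fun z => Complex.exp z * q) (fun n => (hpos n).le) hc
      (by fun_prop) hε (fun x hx hxε => ?_) ht
    have := exp_mul_tsum_eq hpos ha hx (hlim' x hxε) (s := 1) (by simp)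
    rw [mul_one] at this
    exact this.symm
  have hq : q = 0 := by
    have hle : ∀ t : ℝ, 0 < t → ‖q‖ ≤ Real.exp (-t) * ∑' n, ‖c n‖ := by
      intro t ht
      have h1 : ‖Complex.exp t * q‖ ≤ ∑' n, ‖c n‖ := by
        rw [← hall t ht]
        refine tsum_of_norm_bounded hc.hasSum fun n => ?_
        rw [norm_mul]
        exact mul_le_of_le_one_right (norm_nonneg _)
          (norm_exp_neg_ofReal_mul_le_one_s4 ht.le (hpos n).le)
      rw [norm_mul, Complex.norm_exp, Complex.ofReal_re] at h1
      rw [Real.exp_neg, inv_mul_eq_div, le_div_iff₀' (Real.exp_pos t)]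
      exact h1
    have h0 : Tendsto (fun t : ℝ => Real.exp (-t) * ∑' n, ‖c n‖) atTop (𝓝 0) := by
      simpa using Real.tendsto_exp_neg_atTop_nhds_zero.mul_const (∑' n, ‖c n‖)
    exact norm_le_zero_iff.1 (ge_of_tendsto h0 ((eventually_gt_atTop 0).mono hle))
  intro n
  have hcn : c n = 0 := eq_zero_of_tsum_exp_eq_zero hmono hc
    (fun t ht => by rw [hall t ht, hq, mul_zero]) n
  have h1 : (lam n : ℂ) ≠ 0 := by exact_mod_cast (hpos n).ne'
  have h2 : (1 + lam n : ℂ) ≠ 0 := by exact_mod_cast (by linarith [hpos n] : 1 + lam n ≠ 0)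
  simpa [hcdef, h1, h2] using hcn
end

section
/- Let (λ_n)_{n≥1} be positive reals, (a_n)_{n≥1} complex numbers with ∑_{n=1}^∞ |a_n| < ∞, and ε > 0. Define F(τ) = ∑_{n=1}^∞ a_n (1 − e^{−λ_n τ}) for τ ≥ 0 and F(τ) = 0 for τ < 0. Then for every s ∈ ℂ with Re s > 0, the iterated integral ∫_{−ε}^{∞} e^{−st} ( ∫_0^{t+ε} F(τ) dτ ) dt is absolutely convergent and equals s^{−2} e^{εs} · ∑_{n=1}^∞ a_n λ_n (s + λ_n)^{-1}. -/
open Filter Topology MeasureTheory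

/-- A series of functions dominated termwise by `c n * g`, with `c` summable and `g` integrable, has
an integrable sum and may be integrated term by term. -/
theorem integrable_tsum_and_hasSum_integral {α : Type*} [MeasurableSpace α] {μ : Measure α}
    {f : ℕ → α → ℂ} {c : ℕ → ℝ} {g : α → ℝ} (hc : Summable c) (hg : Integrable g μ)
    (hf : ∀ n, AEStronglyMeasurable (f n) μ) (hfg : ∀ n, ∀ᵐ x ∂μ, ‖f n x‖ ≤ c n * g x) :
    Integrable (fun x => ∑' n, f n x) μ ∧
      HasSum (fun n => ∫ x, f n x ∂μ) (∫ x, ∑' n, f n x ∂μ) := by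
  have hsum : ∀ᵐ x ∂μ, HasSum (fun n => f n x) (∑' n, f n x) := by
    filter_upwards [ae_all_iff.2 hfg] with x hx
    exact (Summable.of_norm_bounded (hc.mul_right (g x)) hx).hasSum
  have hbound : Integrable (fun x => ∑' n, c n * g x) μ := by
    simpa only [tsum_mul_right] using hg.const_mul (∑' n, c n)
  refine ⟨hbound.mono' ?_ ?_, ?_⟩
  · refine aestronglyMeasurable_of_tendsto_ae atTop
      (f := fun N x => ∑ n ∈ Finset.range N, f n x) (fun N => ?_) ?_
    · exact Finset.aestronglyMeasurable_fun_sum _ fun n _ => hf n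
    · filter_upwards [hsum] with x hx using hx.tendsto_sum_nat
  · filter_upwards [ae_all_iff.2 hfg] with x hx
    exact tsum_of_norm_bounded (hc.mul_right (g x)).hasSum hx
  · exact hasSum_integral_of_dominated_convergence (fun n x => c n * g x) hf hfg
      (ae_of_all _ fun x => hc.mul_right (g x)) hbound hsum

theorem integrableOn_mul_cexp_neg_mul_Ioi {s : ℂ} (hs : 0 < s.re) :
    IntegrableOn (fun u : ℝ => (u : ℂ) * Complex.exp (-s * u)) (Set.Ioi 0) := by
  have h := integrableOn_rpow_mul_exp_neg_mul_rpow (s := 1) (p := 1) (by norm_num) one_pos hs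
  refine Integrable.mono' h (by fun_prop) ?_
  filter_upwards [ae_restrict_mem measurableSet_Ioi] with u hu
  simp [Complex.norm_exp, abs_of_pos (Set.mem_Ioi.1 hu)]

theorem integral_mul_cexp_neg_mul_Ioi {s : ℂ} (hs : 0 < s.re) :
    ∫ u : ℝ in Set.Ioi 0, (u : ℂ) * Complex.exp (-s * u) = s⁻¹ ^ 2 := by
  have hs0 : s ≠ 0 := by
    rintro rfl
    simp at hs
  have hderiv : ∀ u : ℝ, HasDerivAt
      (fun u : ℝ => -s⁻¹ * ((u : ℂ) * Complex.exp (-s * u)) - s⁻¹ ^ 2 * Complex.exp (-s * u))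
      ((u : ℂ) * Complex.exp (-s * u)) u := by
    intro u
    have h1 : HasDerivAt (fun u : ℝ => (u : ℂ)) 1 u := Complex.ofRealCLM.hasDerivAt
    have h2 := (h1.const_mul (-s)).cexp
    convert! ((h1.mul h2).const_mul (-s⁻¹)).sub (h2.const_mul (s⁻¹ ^ 2)) using 1
    field_simp
    ring
  have hlim (k : ℕ) :
      Tendsto (fun u : ℝ => (u : ℂ) ^ k * Complex.exp (-s * u)) atTop (𝓝 0) := by
    rw [tendsto_zero_iff_norm_tendsto_zero]
    refine (tendsto_rpow_mul_exp_neg_mul_atTop_nhds_zero k s.re hs).congr' ?_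
    filter_upwards [eventually_gt_atTop 0] with u hu
    simp [Complex.norm_exp, abs_of_pos hu]
  have h0 := hlim 0
  have h1 := hlim 1
  simp only [pow_zero, one_mul, pow_one] at h0 h1
  rw [integral_Ioi_of_hasDerivAt_of_tendsto' (fun u _ => hderiv u)
    (integrableOn_mul_cexp_neg_mul_Ioi hs) ((h1.const_mul _).sub (h0.const_mul _))]
  simp

theorem integral_one_sub_cexp_neg_mul {l : ℝ} (hl : 0 < l) (u : ℝ) :
    ∫ τ in (0 : ℝ)..u, (1 - Complex.exp (-(l : ℂ) * (τ : ℂ))) =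
      u - (l : ℂ)⁻¹ * (1 - Complex.exp (-(l : ℂ) * u)) := by
  have hl0 : (l : ℂ) ≠ 0 := by exact_mod_cast hl.ne'
  rw [intervalIntegral.integral_sub (by simp) (Continuous.intervalIntegrable (by fun_prop) _ _),
    integral_exp_mul_complex (neg_ne_zero.2 hl0)]
  simp
  field_simp
  ring

theorem norm_one_sub_cexp_neg_mul_le_one {l τ : ℝ} (hl : 0 < l) (hτ : 0 ≤ τ) :
    ‖1 - Complex.exp (-(l : ℂ) * (τ : ℂ))‖ ≤ 1 := by
  have h : 1 - Complex.exp (-(l : ℂ) * (τ : ℂ)) = ((1 - Real.exp (-l * τ) : ℝ) : ℂ) := by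
    push_cast
    rfl
  have h1 : Real.exp (-l * τ) ≤ 1 := Real.exp_le_one_iff.2 (by nlinarith)
  rw [h, Complex.norm_real, Real.norm_eq_abs, abs_le]
  constructor <;> linarith [Real.exp_pos (-l * τ)]

theorem integral_cexp_neg_mul_integral_one_sub_cexp {s : ℂ} (hs : 0 < s.re) {l : ℝ} (hl : 0 < l) :
    ∫ u : ℝ in Set.Ioi 0, Complex.exp (-s * u) *
        ∫ τ in (0 : ℝ)..u, (1 - Complex.exp (-(l : ℂ) * (τ : ℂ))) =
      s⁻¹ ^ 2 * (l * (s + l)⁻¹) := by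
  have hs0 : s ≠ 0 := by
    rintro rfl
    simp at hs
  have hl0 : (l : ℂ) ≠ 0 := by exact_mod_cast hl.ne'
  have hre : 0 < (s + l).re := by simpa using add_pos hs hl
  have hsl0 : s + l ≠ 0 := fun h => by simp [h] at hre
  have hint {w : ℂ} (hw : 0 < w.re) :
      IntegrableOn (fun u : ℝ => Complex.exp (-w * u)) (Set.Ioi 0) :=
    integrableOn_exp_mul_complex_Ioi (by simpa using hw) 0
  have hval {w : ℂ} (hw : 0 < w.re) : ∫ u : ℝ in Set.Ioi 0, Complex.exp (-w * u) = w⁻¹ := by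
    rw [integral_exp_mul_complex_Ioi (by simpa using hw) 0]
    simp
  have hrw (u : ℝ) : Complex.exp (-s * u) *
      ∫ τ in (0 : ℝ)..u, (1 - Complex.exp (-(l : ℂ) * (τ : ℂ))) =
      u * Complex.exp (-s * u) -
        (l : ℂ)⁻¹ * (Complex.exp (-s * u) - Complex.exp (-(s + l) * u)) := by
    rw [integral_one_sub_cexp_neg_mul hl, show -(s + l) * (u : ℂ) = -s * u + -(l : ℂ) * u by ring,
      Complex.exp_add]
    ring
  simp_rw [hrw]
  have hdiff : IntegrableOn (fun u : ℝ =>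
      (l : ℂ)⁻¹ * (Complex.exp (-s * u) - Complex.exp (-(s + l) * u))) (Set.Ioi 0) :=
    ((hint hs).sub (hint hre)).const_mul _
  rw [integral_sub (integrableOn_mul_cexp_neg_mul_Ioi hs) hdiff, integral_const_mul,
    integral_sub (hint hs) (hint hre), integral_mul_cexp_neg_mul_Ioi hs, hval hs, hval hre]
  field_simp
  ring

theorem norm_integral_one_sub_cexp_neg_mul_le {l u : ℝ} (hl : 0 < l) (hu : 0 ≤ u) :
    ‖∫ τ in (0 : ℝ)..u, (1 - Complex.exp (-(l : ℂ) * (τ : ℂ)))‖ ≤ u := by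
  have h := intervalIntegral.norm_integral_le_of_norm_le_const (a := 0) (b := u) (C := 1)
    (f := fun τ : ℝ => 1 - Complex.exp (-(l : ℂ) * (τ : ℂ))) fun τ hτ =>
      norm_one_sub_cexp_neg_mul_le_one hl (by
        rw [Set.uIoc_of_le hu] at hτ
        exact hτ.1.le)
  simpa [abs_of_nonneg hu] using h

/-- The primitive of `∑ aₙ (1 - e^{-λₙ τ})` is computed term by term. -/
theorem integral_tsum_mul_one_sub_cexp {lam : ℕ → ℝ} (hpos : ∀ n, 0 < lam n)
    {a : ℕ → ℂ} (ha : Summable fun n => ‖a n‖) {u : ℝ} (hu : 0 ≤ u) :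
    ∫ τ in (0 : ℝ)..u, ∑' n, a n * (1 - Complex.exp (-(lam n : ℂ) * (τ : ℂ))) =
      ∑' n, a n * ∫ τ in (0 : ℝ)..u, (1 - Complex.exp (-(lam n : ℂ) * (τ : ℂ))) := by
  have h := integrable_tsum_and_hasSum_integral (μ := volume.restrict (Set.Ioc 0 u))
    (f := fun n (τ : ℝ) => a n * (1 - Complex.exp (-(lam n : ℂ) * (τ : ℂ))))
    (g := fun _ => 1) ha (integrable_const _) (fun n => by fun_prop) fun n => by
      filter_upwards [ae_restrict_mem measurableSet_Ioc] with τ hτ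
      rw [norm_mul]
      gcongr
      exact norm_one_sub_cexp_neg_mul_le_one (hpos n) hτ.1.le
  simp_rw [intervalIntegral.integral_of_le hu, ← h.2.tsum_eq, integral_const_mul]

/-- The Laplace transform of the primitive of `∑ aₙ (1 - e^{-λₙ τ})`. -/
theorem laplace_tsum_integral_one_sub_cexp {lam : ℕ → ℝ} (hpos : ∀ n, 0 < lam n)
    {a : ℕ → ℂ} (ha : Summable fun n => ‖a n‖) {s : ℂ} (hs : 0 < s.re) :
    IntegrableOn (fun u : ℝ => ∑' n, a n * (Complex.exp (-s * u) *
        ∫ τ in (0 : ℝ)..u, (1 - Complex.exp (-(lam n : ℂ) * (τ : ℂ))))) (Set.Ioi 0) ∧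
      ∫ u : ℝ in Set.Ioi 0, ∑' n, a n * (Complex.exp (-s * u) *
        ∫ τ in (0 : ℝ)..u, (1 - Complex.exp (-(lam n : ℂ) * (τ : ℂ)))) =
      s⁻¹ ^ 2 * ∑' n, a n * (lam n : ℂ) * (s + (lam n : ℂ))⁻¹ := by
  have h := integrable_tsum_and_hasSum_integral (μ := volume.restrict (Set.Ioi 0))
    (f := fun n (u : ℝ) => a n * (Complex.exp (-s * u) *
        ∫ τ in (0 : ℝ)..u, (1 - Complex.exp (-(lam n : ℂ) * (τ : ℂ)))))
    ha (integrableOn_mul_cexp_neg_mul_Ioi hs).norm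
    (fun n => by
      simp_rw [integral_one_sub_cexp_neg_mul (hpos n)]
      fun_prop) fun n => by
      filter_upwards [ae_restrict_mem measurableSet_Ioi] with u hu
      have hu' : 0 ≤ u := le_of_lt hu
      rw [norm_mul, norm_mul, norm_mul, mul_comm ‖(u : ℂ)‖, Complex.norm_real, Real.norm_eq_abs,
        abs_of_nonneg hu']
      gcongr
      exact norm_integral_one_sub_cexp_neg_mul_le (hpos n) hu'
  refine ⟨h.1, ?_⟩
  rw [← h.2.tsum_eq, ← tsum_mul_left]
  refine tsum_congr fun n => ?_
  rw [integral_const_mul, integral_cexp_neg_mul_integral_one_sub_cexp hs (hpos n)]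
  ring

/-- The Fubini/Laplace identity
`∫_{-ε}^∞ e^{-st} (∫_0^{t+ε} F) dt = s⁻² e^{εs} ∑ aₙ λₙ (s+λₙ)⁻¹`
from the proof of Lemma 3.6. -/
theorem stmt_5 (lam : ℕ → ℝ) (hpos : ∀ n, 0 < lam n)
    (a : ℕ → ℂ) (ha : Summable fun n => ‖a n‖)
    (ε : ℝ) (hε : 0 < ε)
    (F : ℝ → ℂ)
    (hF : ∀ τ : ℝ, F τ =
      if 0 ≤ τ then ∑' n : ℕ, a n * (1 - Complex.exp (-(lam n : ℂ) * (τ : ℂ))) else 0)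
    (s : ℂ) (hs : 0 < s.re) :
    IntegrableOn
      (fun t : ℝ => Complex.exp (-s * (t : ℂ)) * ∫ τ in (0 : ℝ)..(t + ε), F τ)
      (Set.Ioi (-ε)) ∧
    (∫ t in Set.Ioi (-ε), Complex.exp (-s * (t : ℂ)) * ∫ τ in (0 : ℝ)..(t + ε), F τ)
      = s⁻¹ ^ 2 * Complex.exp ((ε : ℂ) * s) *
          ∑' n : ℕ, a n * (lam n : ℂ) * (s + (lam n : ℂ))⁻¹ := by
  obtain ⟨hint, hval⟩ := laplace_tsum_integral_one_sub_cexp hpos ha hs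
  set h : ℝ → ℂ := fun u => ∑' n, a n * (Complex.exp (-s * u) *
    ∫ τ in (0 : ℝ)..u, (1 - Complex.exp (-(lam n : ℂ) * (τ : ℂ)))) with hh
  have hshift : Set.EqOn
      (fun t : ℝ => Complex.exp (-s * (t : ℂ)) * ∫ τ in (0 : ℝ)..(t + ε), F τ)
      (fun t : ℝ => Complex.exp ((ε : ℂ) * s) * h (t + ε)) (Set.Ioi (-ε)) := by
    intro t ht
    have hu : 0 ≤ t + ε := by linarith [Set.mem_Ioi.1 ht]
    have hFint : ∫ τ in (0 : ℝ)..(t + ε), F τ = ∑' n, a n *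
        ∫ τ in (0 : ℝ)..(t + ε), (1 - Complex.exp (-(lam n : ℂ) * (τ : ℂ))) := by
      rw [← integral_tsum_mul_one_sub_cexp hpos ha hu]
      refine intervalIntegral.integral_congr fun τ hτ => ?_
      rw [Set.uIcc_of_le hu] at hτ
      simp only [hF, if_pos hτ.1]
    have hexp : Complex.exp (-s * (t : ℂ)) =
        Complex.exp ((ε : ℂ) * s) * Complex.exp (-s * ((t + ε : ℝ) : ℂ)) := by
      rw [← Complex.exp_add]
      congr 1
      push_cast
      ring
    simp only [hh, hFint, hexp, mul_left_comm (a _), tsum_mul_left, mul_assoc]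
  have hmp := measurePreserving_add_right (volume : Measure ℝ) ε
  have hemb := (Homeomorph.addRight ε).measurableEmbedding
  have hpre : (fun t : ℝ => t + ε) ⁻¹' Set.Ioi 0 = Set.Ioi (-ε) := by simp
  constructor
  · rw [integrableOn_congr_fun hshift measurableSet_Ioi, ← hpre]
    exact ((hmp.integrableOn_comp_preimage hemb).2 hint).const_mul _
  · rw [setIntegral_congr_fun measurableSet_Ioi hshift, integral_const_mul, ← hpre,
      hmp.setIntegral_preimage_emb hemb h, hval]
    ring
end

section
/- Let (λ_n)_{n≥1} be positive reals and (a_n)_{n≥1} complex numbers with ∑_{n=1}^∞ |a_n| < ∞. Then for every s ∈ ℂ with Re s > 0, the function t ↦ e^{−st} ∑_{n=1}^∞ a_n (1 − e^{−λ_n t}) is integrable on (0, ∞) and ∫_0^∞ e^{−st} ( ∑_{n=1}^∞ a_n (1 − e^{−λ_n t}) ) dt = ∑_{n=1}^∞ a_n λ_n s^{−1}(s + λ_n)^{−1}. -/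
open Filter Topology MeasureTheory

lemma norm_mul_one_sub_exp_le {l t : ℝ} (hl : 0 < l) (ht : 0 ≤ t) (c : ℂ) :
    ‖c * (1 - Complex.exp (-(l : ℂ) * (t : ℂ)))‖ ≤ ‖c‖ * 2 := by
  rw [norm_mul]
  gcongr
  have h : ‖Complex.exp (-(l : ℂ) * (t : ℂ))‖ ≤ 1 := by
    rw [Complex.norm_exp, Real.exp_le_one_iff]
    simpa using mul_nonneg hl.le ht
  calc ‖1 - Complex.exp (-(l : ℂ) * (t : ℂ))‖
      ≤ ‖(1 : ℂ)‖ + ‖Complex.exp (-(l : ℂ) * (t : ℂ))‖ := norm_sub_le _ _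
    _ ≤ 2 := by rw [norm_one]; linarith

lemma integral_exp_mul_one_sub_exp {l : ℝ} (hl : 0 < l) {s : ℂ} (hs : 0 < s.re) (c : ℂ) :
    ∫ t in Set.Ioi (0 : ℝ), Complex.exp (-s * (t : ℂ)) *
        (c * (1 - Complex.exp (-(l : ℂ) * (t : ℂ))))
      = c * (l : ℂ) * s⁻¹ * (s + (l : ℂ))⁻¹ := by
  have h₁ : (-s).re < 0 := by simpa using hs
  have h₂ : (-(s + (l : ℂ))).re < 0 := by
    simp only [Complex.neg_re, Complex.add_re, Complex.ofReal_re]; linarith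
  have hs0 : s ≠ 0 := by rintro rfl; simp at hs
  have hsl : s + (l : ℂ) ≠ 0 := by intro h; simp [h] at h₂
  have hfun : (fun t : ℝ => Complex.exp (-s * (t : ℂ)) *
        (c * (1 - Complex.exp (-(l : ℂ) * (t : ℂ))))) =
      fun t : ℝ => c * (Complex.exp (-s * t) - Complex.exp (-(s + (l : ℂ)) * t)) := by
    funext t
    rw [show -(s + (l : ℂ)) * t = -s * t + -(l : ℂ) * t by ring, Complex.exp_add]
    ring
  rw [hfun, integral_const_mul, integral_sub (integrableOn_exp_mul_complex_Ioi h₁ 0)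
    (integrableOn_exp_mul_complex_Ioi h₂ 0), integral_exp_mul_complex_Ioi h₁,
    integral_exp_mul_complex_Ioi h₂]
  simp only [Complex.ofReal_zero, mul_zero, Complex.exp_zero, neg_div_neg_eq]
  field_simp
  ring

/-- Termwise Laplace transform:
`∫_0^∞ e^{-st} ∑ aₙ (1 - e^{-λₙ t}) dt = ∑ aₙ λₙ s⁻¹ (s+λₙ)⁻¹` for `Re s > 0`.
(Section 3.2 of the paper.) -/
theorem stmt_8 (lam : ℕ → ℝ) (hpos : ∀ n, 0 < lam n)
    (a : ℕ → ℂ) (ha : Summable fun n => ‖a n‖)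
    (s : ℂ) (hs : 0 < s.re) :
    IntegrableOn
      (fun t : ℝ => Complex.exp (-s * (t : ℂ)) *
        ∑' n : ℕ, a n * (1 - Complex.exp (-(lam n : ℂ) * (t : ℂ))))
      (Set.Ioi (0 : ℝ)) ∧
    (∫ t in Set.Ioi (0 : ℝ), Complex.exp (-s * (t : ℂ)) *
        ∑' n : ℕ, a n * (1 - Complex.exp (-(lam n : ℂ) * (t : ℂ))))
      = ∑' n : ℕ, a n * (lam n : ℂ) * s⁻¹ * (s + (lam n : ℂ))⁻¹ := by
  have hexp : IntegrableOn (fun t : ℝ => Complex.exp (-s * (t : ℂ))) (Set.Ioi 0) :=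
    integrableOn_exp_mul_complex_Ioi (by simpa using hs) 0
  have ha2 : Summable fun n => ‖a n‖ * 2 := ha.mul_right 2
  have hbound : ∀ n, ∀ t ∈ Set.Ioi (0 : ℝ),
      ‖a n * (1 - Complex.exp (-(lam n : ℂ) * (t : ℂ)))‖ ≤ ‖a n‖ * 2 :=
    fun n t ht => norm_mul_one_sub_exp_le (hpos n) (le_of_lt ht) (a n)
  have hcont : ContinuousOn
      (fun t : ℝ => ∑' n : ℕ, a n * (1 - Complex.exp (-(lam n : ℂ) * (t : ℂ))))
      (Set.Ioi 0) :=
    continuousOn_tsum (fun n => by fun_prop) ha2 hbound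
  refine ⟨?_, ?_⟩
  · refine Integrable.mul_bdd (c := ∑' n, ‖a n‖ * 2) hexp
      (hcont.aestronglyMeasurable measurableSet_Ioi) ?_
    filter_upwards [ae_restrict_mem measurableSet_Ioi] with t ht
    exact tsum_of_norm_bounded ha2.hasSum fun n => hbound n t ht
  · have key := hasSum_integral_of_dominated_convergence
      (μ := volume.restrict (Set.Ioi (0 : ℝ)))
      (F := fun n (t : ℝ) => Complex.exp (-s * (t : ℂ)) *
        (a n * (1 - Complex.exp (-(lam n : ℂ) * (t : ℂ)))))
      (f := fun t : ℝ => Complex.exp (-s * (t : ℂ)) *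
        ∑' n : ℕ, a n * (1 - Complex.exp (-(lam n : ℂ) * (t : ℂ))))
      (fun n t => ‖Complex.exp (-s * (t : ℂ))‖ * (‖a n‖ * 2))
      (fun n => Continuous.aestronglyMeasurable (by fun_prop))
      (fun n => by
        filter_upwards [ae_restrict_mem measurableSet_Ioi] with t ht
        rw [norm_mul]
        gcongr
        exact hbound n t ht)
      (Eventually.of_forall fun t => ha2.mul_left _)
      (by
        simp only [tsum_mul_left]
        exact hexp.norm.mul_const _)
      (by
        filter_upwards [ae_restrict_mem measurableSet_Ioi] with t ht
        exact (Summable.of_norm_bounded ha2 fun n => hbound n t ht).hasSum.mul_left _)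
    rw [← key.tsum_eq]
    exact tsum_congr fun n => integral_exp_mul_one_sub_exp (hpos n) hs (a n)
end

section
/- Let (λ_n)_{n≥1} be positive reals, let 0 ≤ t_0 < t_1 < … < t_K be a finite mesh, and for 1 ≤ k ≤ K let a_k : ℕ → ℂ with ∑_{k=1}^K ∑_{n=1}^∞ |a_{k,n}| < ∞. Define G(t) = ∫_0^t ∑_{k=1}^K χ_{t−τ ∈ [t_{k−1}, t_k)} ( ∑_{n=1}^∞ a_{k,n} (1 − e^{−λ_n τ}) ) dτ for t > 0. Then for every s ∈ ℂ with Re s > 0: s² ∫_0^∞ e^{−st} G(t) dt = ∑_{k=1}^K (e^{−t_{k−1}s} − e^{−t_k s}) · ∑_{n=1}^∞ a_{k,n} λ_n (s + λ_n)^{−1}. -/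
open Filter Topology MeasureTheory

/-- The series `∑ₙ cₙ (1 - e^{-λₙ τ})`. -/
noncomputable def relaxationSeries (lam : ℕ → ℝ) (c : ℕ → ℂ) (τ : ℝ) : ℂ :=
  ∑' n : ℕ, c n * (1 - Complex.exp (-(lam n : ℂ) * (τ : ℂ)))

lemma norm_one_sub_cexp_neg_mul_le {l τ : ℝ} (hl : 0 ≤ l) (hτ : 0 ≤ τ) :
    ‖1 - Complex.exp (-(l : ℂ) * (τ : ℂ))‖ ≤ 2 := by
  have h : ‖Complex.exp (-(l : ℂ) * (τ : ℂ))‖ ≤ 1 := by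
    rw [Complex.norm_exp, Real.exp_le_one_iff]
    simpa using mul_nonneg hl hτ
  calc _ ≤ ‖(1 : ℂ)‖ + ‖Complex.exp (-(l : ℂ) * (τ : ℂ))‖ := norm_sub_le _ _
    _ ≤ 2 := by rw [norm_one]; linarith

lemma norm_relaxation_term_le {l τ : ℝ} (hl : 0 ≤ l) (hτ : 0 ≤ τ) (c : ℂ) :
    ‖c * (1 - Complex.exp (-(l : ℂ) * (τ : ℂ)))‖ ≤ ‖c‖ * 2 := by
  rw [norm_mul]
  exact mul_le_mul_of_nonneg_left (norm_one_sub_cexp_neg_mul_le hl hτ) (norm_nonneg c)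

lemma continuousOn_relaxationSeries {lam : ℕ → ℝ} (hlam : ∀ n, 0 ≤ lam n) {c : ℕ → ℂ}
    (hc : Summable fun n => ‖c n‖) : ContinuousOn (relaxationSeries lam c) (Set.Ici 0) :=
  continuousOn_tsum (fun n => by fun_prop) (hc.mul_right 2)
    fun n _ hτ => norm_relaxation_term_le (hlam n) hτ (c n)

lemma norm_relaxationSeries_le {lam : ℕ → ℝ} (hlam : ∀ n, 0 ≤ lam n) {c : ℕ → ℂ}
    (hc : Summable fun n => ‖c n‖) {τ : ℝ} (hτ : 0 ≤ τ) :
    ‖relaxationSeries lam c τ‖ ≤ ∑' n, ‖c n‖ * 2 :=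
  tsum_of_norm_bounded (hc.mul_right 2).hasSum
    fun n => norm_relaxation_term_le (hlam n) hτ (c n)

lemma integrableOn_cexp_neg_mul {s : ℂ} (hs : 0 < s.re) :
    IntegrableOn (fun τ : ℝ => Complex.exp (-s * (τ : ℂ))) (Set.Ioi 0) :=
  integrableOn_exp_mul_complex_Ioi (by simpa using hs) 0

lemma integral_cexp_neg_mul {s : ℂ} (hs : 0 < s.re) :
    ∫ τ in Set.Ioi (0 : ℝ), Complex.exp (-s * (τ : ℂ)) = s⁻¹ := by
  rw [integral_exp_mul_complex_Ioi (by simpa using hs)]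
  simp [neg_div_neg_eq]

lemma integrableOn_cexp_mul_relaxationSeries {lam : ℕ → ℝ} (hlam : ∀ n, 0 ≤ lam n) {c : ℕ → ℂ}
    (hc : Summable fun n => ‖c n‖) {s : ℂ} (hs : 0 < s.re) :
    IntegrableOn (fun τ : ℝ => Complex.exp (-s * (τ : ℂ)) * relaxationSeries lam c τ)
      (Set.Ioi 0) := by
  refine ((integrableOn_cexp_neg_mul hs).norm.mul_const (∑' n, ‖c n‖ * 2)).mono'
    (ContinuousOn.aestronglyMeasurable ?_ measurableSet_Ioi) ?_
  · exact ContinuousOn.mul (by fun_prop)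
      ((continuousOn_relaxationSeries hlam hc).mono Set.Ioi_subset_Ici_self)
  · filter_upwards [ae_restrict_mem measurableSet_Ioi] with τ hτ
    rw [norm_mul]
    exact mul_le_mul_of_nonneg_left (norm_relaxationSeries_le hlam hc (le_of_lt hτ))
      (norm_nonneg _)

/-- Laplace transform of a single relaxation term `1 - e^{-l τ}`. -/
lemma integrableOn_and_integral_cexp_mul_one_sub {l : ℝ} (hl : 0 ≤ l) {s : ℂ} (hs : 0 < s.re) :
    IntegrableOn (fun τ : ℝ => Complex.exp (-s * (τ : ℂ)) *
        (1 - Complex.exp (-(l : ℂ) * (τ : ℂ)))) (Set.Ioi 0) ∧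
      ∫ τ in Set.Ioi (0 : ℝ), Complex.exp (-s * (τ : ℂ)) *
        (1 - Complex.exp (-(l : ℂ) * (τ : ℂ))) = s⁻¹ * (l * (s + l)⁻¹) := by
  have hsl : 0 < (s + l).re := by simpa using add_pos_of_pos_of_nonneg hs hl
  have heq : (fun τ : ℝ => Complex.exp (-s * (τ : ℂ)) *
      (1 - Complex.exp (-(l : ℂ) * (τ : ℂ)))) = fun τ : ℝ =>
        Complex.exp (-s * (τ : ℂ)) - Complex.exp (-(s + l) * (τ : ℂ)) := by
    ext τ
    rw [mul_sub, mul_one, ← Complex.exp_add]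
    ring_nf
  rw [heq]
  refine ⟨(integrableOn_cexp_neg_mul hs).sub (integrableOn_cexp_neg_mul hsl), ?_⟩
  rw [integral_sub (integrableOn_cexp_neg_mul hs) (integrableOn_cexp_neg_mul hsl),
    integral_cexp_neg_mul hs, integral_cexp_neg_mul hsl]
  have h1 : s ≠ 0 := fun h => by simp [h] at hs
  have h2 : s + l ≠ 0 := fun h => by simp [h] at hsl
  field_simp
  ring

lemma integral_cexp_mul_relaxationSeries {lam : ℕ → ℝ} (hlam : ∀ n, 0 ≤ lam n) {c : ℕ → ℂ}
    (hc : Summable fun n => ‖c n‖) {s : ℂ} (hs : 0 < s.re) :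
    ∫ τ in Set.Ioi (0 : ℝ), Complex.exp (-s * (τ : ℂ)) * relaxationSeries lam c τ =
      s⁻¹ * ∑' n : ℕ, c n * (lam n : ℂ) * (s + (lam n : ℂ))⁻¹ := by
  set F : ℕ → ℝ → ℂ := fun n τ => c n * (Complex.exp (-s * (τ : ℂ)) *
    (1 - Complex.exp (-(lam n : ℂ) * (τ : ℂ)))) with hF
  have hint : ∀ n, IntegrableOn (F n) (Set.Ioi 0) := fun n =>
    (integrableOn_and_integral_cexp_mul_one_sub (hlam n) hs).1.const_mul (c n)
  have hsum : Summable fun n => ∫ τ in Set.Ioi (0 : ℝ), ‖F n τ‖ := by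
    refine Summable.of_nonneg_of_le (fun n => integral_nonneg fun τ => norm_nonneg _) (fun n => ?_)
      (hc.mul_right (2 * ∫ τ in Set.Ioi (0 : ℝ), ‖Complex.exp (-s * (τ : ℂ))‖))
    rw [← integral_const_mul, ← integral_const_mul]
    refine setIntegral_mono_on (hint n).norm
      (((integrableOn_cexp_neg_mul hs).norm.const_mul _).const_mul _) measurableSet_Ioi
      fun τ hτ => ?_
    rw [hF, norm_mul, norm_mul, mul_comm (2 : ℝ)]
    gcongr
    exact norm_one_sub_cexp_neg_mul_le (hlam n) (le_of_lt hτ)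
  have hpt : ∀ τ : ℝ, Complex.exp (-s * (τ : ℂ)) * relaxationSeries lam c τ = ∑' n, F n τ := by
    intro τ
    rw [relaxationSeries, ← tsum_mul_left]
    exact tsum_congr fun n => by rw [hF]; ring
  simp_rw [hpt]
  rw [← integral_tsum_of_summable_integral_norm hint hsum, ← tsum_mul_left]
  refine tsum_congr fun n => ?_
  rw [hF, integral_const_mul, (integrableOn_and_integral_cexp_mul_one_sub (hlam n) hs).2]
  ring

/-- Laplace transform of the indicator of `[p, q)`. -/
lemma integral_cexp_mul_indicator_Ico {p q : ℝ} (hp : 0 ≤ p) (hpq : p ≤ q) {s : ℂ} (hs : s ≠ 0) :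
    ∫ u in Set.Ioi (0 : ℝ), (Set.Ico p q).indicator (fun u : ℝ => Complex.exp (-s * (u : ℂ))) u =
      s⁻¹ * (Complex.exp (-(p : ℂ) * s) - Complex.exp (-(q : ℂ) * s)) := by
  rw [← integral_Ici_eq_integral_Ioi, setIntegral_indicator measurableSet_Ico,
    Set.inter_eq_right.mpr (Set.Ico_subset_Ici_self.trans (Set.Ici_subset_Ici.mpr hp)), integral_Ico_eq_integral_Ioc,
    ← intervalIntegral.integral_of_le hpq, integral_exp_mul_complex (neg_ne_zero.mpr hs)]
  rw [show -s * (q : ℂ) = -q * s by ring, show -s * (p : ℂ) = -p * s by ring]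
  field_simp
  ring

lemma intervalIntegrable_ite_mul_relaxationSeries {lam : ℕ → ℝ} (hlam : ∀ n, 0 ≤ lam n)
    {c : ℕ → ℂ} (hc : Summable fun n => ‖c n‖) (p q : ℝ) {t : ℝ} (ht : 0 ≤ t) :
    IntervalIntegrable (fun τ => (if p ≤ t - τ ∧ t - τ < q then (1 : ℂ) else 0) *
      relaxationSeries lam c τ) volume 0 t := by
  have hm : MeasurableSet {τ : ℝ | p ≤ t - τ ∧ t - τ < q} :=
    (measurableSet_Ico (a := p) (b := q)).preimage (measurable_const.sub measurable_id)
  have hF : IntervalIntegrable (relaxationSeries lam c) volume 0 t :=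
    ((continuousOn_relaxationSeries hlam hc).mono (by
      rw [Set.uIcc_of_le ht]; exact Set.Icc_subset_Ici_self)).intervalIntegrable
  rw [intervalIntegrable_iff] at hF ⊢
  refine (IntegrableOn.indicator hF hm).congr (Eventually.of_forall fun τ => ?_)
  simp [Set.indicator_apply]

/-- The integrand of the Laplace transform, as a convolution of exponentially damped functions. -/
lemma cexp_mul_intervalIntegral_ite_mul (F : ℝ → ℂ) (s : ℂ) (p q t : ℝ) :
    Complex.exp (-s * (t : ℂ)) * ∫ τ in (0 : ℝ)..t,
        (if p ≤ t - τ ∧ t - τ < q then (1 : ℂ) else 0) * F τ =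
      ∫ τ in (0 : ℝ)..t, ContinuousLinearMap.mul ℝ ℂ (Complex.exp (-s * (τ : ℂ)) * F τ)
        ((Set.Ico p q).indicator (fun u : ℝ => Complex.exp (-s * (u : ℂ))) (t - τ)) := by
  rw [← intervalIntegral.integral_const_mul]
  congr 1 with τ
  have h : Complex.exp (-s * (t : ℂ)) =
      Complex.exp (-s * (τ : ℂ)) * Complex.exp (-s * ((t - τ : ℝ) : ℂ)) := by
    rw [← Complex.exp_add]
    push_cast
    ring_nf
  rw [h, ContinuousLinearMap.mul_apply', Set.indicator_apply]
  simp only [Set.mem_Ico]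
  split_ifs <;> ring

/-- Identity (3.1) of the paper:
`s² L{G}(s) = ∑ₖ (e^{-t_{k-1}s} - e^{-t_k s}) ∑ₙ a_{k,n} λₙ (s+λₙ)⁻¹`,
where `G(t) = ∫_0^t ∑ₖ χ_{t-τ ∈ [t_{k-1}, t_k)} ∑ₙ a_{k,n}(1 - e^{-λₙ τ}) dτ`. -/
theorem stmt_9 (lam : ℕ → ℝ) (hpos : ∀ n, 0 < lam n)
    (K : ℕ) (hK : 1 ≤ K) (tm : ℕ → ℝ)
    (htm0 : 0 ≤ tm 0) (htm : ∀ k < K, tm k < tm (k + 1))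
    (a : ℕ → ℕ → ℂ) (ha : ∀ k < K, Summable fun n => ‖a k n‖)
    (s : ℂ) (hs : 0 < s.re) :
    s ^ 2 * ∫ t in Set.Ioi (0 : ℝ), Complex.exp (-s * (t : ℂ)) *
        ∫ τ in (0 : ℝ)..t, ∑ k ∈ Finset.range K,
          (if tm k ≤ t - τ ∧ t - τ < tm (k + 1) then (1 : ℂ) else 0) *
            ∑' n : ℕ, a k n * (1 - Complex.exp (-(lam n : ℂ) * (τ : ℂ)))
      = ∑ k ∈ Finset.range K,
          (Complex.exp (-(tm k : ℂ) * s) - Complex.exp (-(tm (k + 1) : ℂ) * s)) *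
            ∑' n : ℕ, a k n * (lam n : ℂ) * (s + (lam n : ℂ))⁻¹ := by
  have hlam : ∀ n, 0 ≤ lam n := fun n => (hpos n).le
  have hs0 : s ≠ 0 := fun h => by simp [h] at hs
  have htm_nonneg : ∀ k ≤ K, 0 ≤ tm k := by
    intro k
    induction k with
    | zero => exact fun _ => htm0
    | succ k ih => exact fun hk => (ih (by omega)).trans (htm k (by omega)).le
  set f : ℕ → ℝ → ℂ := fun k τ => Complex.exp (-s * (τ : ℂ)) * relaxationSeries lam (a k) τ
  set g : ℕ → ℝ → ℂ := fun k =>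
    (Set.Ico (tm k) (tm (k + 1))).indicator fun u : ℝ => Complex.exp (-s * (u : ℂ))
  have hf : ∀ k < K, IntegrableOn (f k) (Set.Ioi 0) := fun k hk =>
    integrableOn_cexp_mul_relaxationSeries hlam (ha k hk) hs
  have hg : ∀ k, IntegrableOn (g k) (Set.Ioi 0) := fun k =>
    (integrableOn_cexp_neg_mul hs).indicator measurableSet_Ico
  have hconv : ∀ k < K, IntegrableOn (fun t : ℝ => ∫ τ in (0 : ℝ)..t,
      ContinuousLinearMap.mul ℝ ℂ (f k τ) (g k (t - τ))) (Set.Ioi 0) := fun k hk =>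
    (integrable_indicator_iff measurableSet_Ioi).mp
      (integrable_posConvolution (hf k hk) (hg k) (ContinuousLinearMap.mul ℝ ℂ))
  have hsplit : ∀ t ∈ Set.Ioi (0 : ℝ), Complex.exp (-s * (t : ℂ)) *
        ∫ τ in (0 : ℝ)..t, ∑ k ∈ Finset.range K,
          (if tm k ≤ t - τ ∧ t - τ < tm (k + 1) then (1 : ℂ) else 0) *
            ∑' n : ℕ, a k n * (1 - Complex.exp (-(lam n : ℂ) * (τ : ℂ))) =
      ∑ k ∈ Finset.range K, ∫ τ in (0 : ℝ)..t,
        ContinuousLinearMap.mul ℝ ℂ (f k τ) (g k (t - τ)) := by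
    intro t ht
    have hser : ∀ (k : ℕ) (τ : ℝ), ∑' n : ℕ, a k n * (1 - Complex.exp (-(lam n : ℂ) * (τ : ℂ))) =
      relaxationSeries lam (a k) τ := fun _ _ => rfl
    simp only [hser]
    rw [intervalIntegral.integral_finsetSum fun k hk =>
      intervalIntegrable_ite_mul_relaxationSeries hlam (ha k (Finset.mem_range.mp hk)) _ _
        (le_of_lt ht), Finset.mul_sum]
    exact Finset.sum_congr rfl fun k _ =>
      cexp_mul_intervalIntegral_ite_mul (relaxationSeries lam (a k)) s _ _ t
  rw [setIntegral_congr_fun measurableSet_Ioi hsplit,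
    integral_finsetSum _ fun k hk => hconv k (Finset.mem_range.mp hk), Finset.mul_sum]
  refine Finset.sum_congr rfl fun k hk => ?_
  have hk' := Finset.mem_range.mp hk
  rw [integral_posConvolution (hf k hk') (hg k), ContinuousLinearMap.mul_apply',
    integral_cexp_mul_relaxationSeries hlam (ha k hk') hs,
    integral_cexp_mul_indicator_Ico (htm_nonneg k hk'.le) (htm k hk').le hs0]
  field_simp
end

section
/- Let 0 ≤ t_0 < t_1 < … < t_K be a finite mesh and let g_1, …, g_K : ℝ → ℂ be locally integrable functions. Define h : [0, ∞) → ℂ by: h(τ) = 0 for τ ∈ [0, t_0]; h(τ) = g_m(τ − t_{m−1}) + ∑_{l=1}^{m−1} [g_l(τ − t_{l−1}) − g_l(τ − t_l)] for τ ∈ (t_{m−1}, t_m] with 1 ≤ m ≤ K; and h(τ) = ∑_{l=1}^{K} [g_l(τ − t_{l−1}) − g_l(τ − t_l)] for τ > t_K. Then for every t > 0: ∫_0^t h(τ) dτ = ∫_0^t ∑_{k=1}^K χ_{t−τ ∈ [t_{k−1}, t_k)} g_k(τ) dτ. -/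
open Filter Topology MeasureTheory

/-- A finite mesh that increases at every step is monotone up to its last index. -/
lemma mesh_le_of_le {K : ℕ} {u : ℕ → ℝ} (hu : ∀ k < K, u k < u (k + 1)) {i j : ℕ}
    (hij : i ≤ j) (hj : j ≤ K) : u i ≤ u j := by
  induction j, hij using Nat.le_induction with
  | base => exact le_rfl
  | succ n _ ih => exact (ih (by omega)).trans (hu n (by omega)).le

/-- The function `f` cut off outside `(0, b]`. -/
noncomputable def cutoff (f : ℝ → ℂ) (b : ℝ) : ℝ → ℂ := (Set.Ioc 0 b).indicator f

lemma cutoff_of_mem {f : ℝ → ℂ} {b x : ℝ} (h₀ : 0 < x) (hb : x ≤ b) : cutoff f b x = f x :=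
  Set.indicator_of_mem (Set.mem_Ioc.2 ⟨h₀, hb⟩) f

lemma cutoff_of_nonpos {f : ℝ → ℂ} {b x : ℝ} (h₀ : x ≤ 0) : cutoff f b x = 0 :=
  Set.indicator_of_notMem (fun hx => h₀.not_gt hx.1) f

lemma cutoff_of_gt {f : ℝ → ℂ} {b x : ℝ} (hb : b < x) : cutoff f b x = 0 :=
  Set.indicator_of_notMem (fun hx => hb.not_ge hx.2) f

lemma integrable_cutoff {f : ℝ → ℂ} (hf : LocallyIntegrable f volume) (b : ℝ) :
    Integrable (cutoff f b) :=
  ((hf.integrableOn_isCompact isCompact_Icc).mono_set Set.Ioc_subset_Icc_self).integrable_indicator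
    measurableSet_Ioc

/-- Shifting the summands of a finite sum of differences of cutoffs does not change its
integral. -/
lemma integral_sum_cutoff_shift (K : ℕ) (u : ℕ → ℝ) {g : ℕ → ℝ → ℂ}
    (hg : ∀ k, LocallyIntegrable (g k) volume) (t : ℝ) :
    ∫ x, ∑ l ∈ Finset.range K,
        (cutoff (g l) (t - u l) (x - u l) - cutoff (g l) (t - u (l + 1)) (x - u (l + 1)))
      = ∫ x, ∑ l ∈ Finset.range K,
        (cutoff (g l) (t - u l) x - cutoff (g l) (t - u (l + 1)) x) := by
  have hi (l : ℕ) (b : ℝ) := integrable_cutoff (hg l) b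
  rw [integral_finsetSum, integral_finsetSum]
  rotate_left
  · exact fun l _ => (hi l _).sub (hi l _)
  · exact fun l _ => ((hi l _).comp_sub_right _).sub ((hi l _).comp_sub_right _)
  refine Finset.sum_congr rfl fun l _ => ?_
  rw [integral_sub ((hi l _).comp_sub_right _) ((hi l _).comp_sub_right _),
    integral_sub (hi l _) (hi l _), integral_sub_right_eq_self (cutoff (g l) (t - u l)),
    integral_sub_right_eq_self (cutoff (g l) (t - u (l + 1)))]

/-- The telescoping/change-of-variables rearrangement of Corollary 3.2:
with `h` defined piecewise from locally integrable `g₁, …, g_K`, one has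
`∫_0^t h(τ) dτ = ∫_0^t ∑ₖ χ_{t-τ ∈ [t_{k-1}, t_k)} g_k(τ) dτ`. -/
theorem stmt_10 (K : ℕ) (hK : 1 ≤ K) (tm : ℕ → ℝ)
    (htm0 : 0 ≤ tm 0) (htm : ∀ k < K, tm k < tm (k + 1))
    (g : ℕ → ℝ → ℂ) (hg : ∀ k, MeasureTheory.LocallyIntegrable (g k) volume)
    (h : ℝ → ℂ)
    (h0 : ∀ τ : ℝ, 0 ≤ τ → τ ≤ tm 0 → h τ = 0)
    (hmid : ∀ m < K, ∀ τ : ℝ, tm m < τ → τ ≤ tm (m + 1) →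
      h τ = g m (τ - tm m) +
        ∑ l ∈ Finset.range m, (g l (τ - tm l) - g l (τ - tm (l + 1))))
    (hend : ∀ τ : ℝ, tm K < τ →
      h τ = ∑ l ∈ Finset.range K, (g l (τ - tm l) - g l (τ - tm (l + 1)))) :
    ∀ t : ℝ, 0 < t →
      (∫ τ in (0 : ℝ)..t, h τ)
        = ∫ τ in (0 : ℝ)..t, ∑ k ∈ Finset.range K,
            (if tm k ≤ t - τ ∧ t - τ < tm (k + 1) then g k τ else 0) := by
  intro t ht
  have hpos (k : ℕ) (hk : k ≤ K) : 0 ≤ tm k := htm0.trans (mesh_le_of_le htm k.zero_le hk)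
  rw [intervalIntegral.integral_of_le ht.le, intervalIntegral.integral_of_le ht.le,
    ← integral_indicator measurableSet_Ioc, ← integral_indicator measurableSet_Ioc]
  refine Eq.trans ?_ ((integral_sum_cutoff_shift K tm hg t).trans ?_)
  · congr 1
    funext x
    by_cases hx : x ∈ Set.Ioc 0 t
    · rw [Set.indicator_of_mem hx]
      have before (l k : ℕ) (hk : x ≤ tm k) : cutoff (g l) (t - tm k) (x - tm k) = 0 :=
        cutoff_of_nonpos (by linarith)
      have after (l k : ℕ) (hk : tm k < x) :
          cutoff (g l) (t - tm k) (x - tm k) = g l (x - tm k) :=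
        cutoff_of_mem (by linarith) (by linarith [hx.2])
      rcases lt_or_ge (tm K) x with hK' | hK'
      · rw [hend x hK']
        refine Finset.sum_congr rfl fun l hl => ?_
        have hl := Finset.mem_range.1 hl
        rw [after l l ((mesh_le_of_le htm hl.le le_rfl).trans_lt hK'),
          after l (l + 1) ((mesh_le_of_le htm hl le_rfl).trans_lt hK')]
      · have hex : ∃ k, x ≤ tm k := ⟨K, hK'⟩
        classical
        obtain ⟨n, hn, hmin⟩ : ∃ n, x ≤ tm n ∧ ∀ k < n, tm k < x :=
          ⟨Nat.find hex, Nat.find_spec hex, fun k hk => not_le.1 (Nat.find_min hex hk)⟩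
        have hnK : n ≤ K := by
          by_contra! hlt
          exact (hmin K hlt).not_ge hK'
        have hge (k : ℕ) (hk : n ≤ k) (hkK : k ≤ K) : x ≤ tm k :=
          hn.trans (mesh_le_of_le htm hk hkK)
        rw [← Finset.sum_subset (Finset.range_mono hnK) fun l hl hln => by
          rw [Finset.mem_range] at hl hln
          rw [before l l (hge l (by omega) hl.le), before l (l + 1) (hge _ (by omega) hl), sub_zero]]
        rcases n with _ | m
        · rw [h0 x hx.1.le hn, Finset.sum_range_zero]
        · rw [hmid m hnK x (hmin m m.lt_succ_self) hn, Finset.sum_range_succ, add_comm,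
            after m m (hmin m m.lt_succ_self), before m (m + 1) hn, sub_zero]
          congr 1
          refine Finset.sum_congr rfl fun l hl => ?_
          have hl := Finset.mem_range.1 hl
          rw [after l l (hmin l (by omega)), after l (l + 1) (hmin _ (by omega))]
    · rw [Set.indicator_of_notMem hx]
      refine (Finset.sum_eq_zero fun l hl => ?_).symm
      have hl := Finset.mem_range.1 hl
      have vanish (k : ℕ) (hk : k ≤ K) : cutoff (g l) (t - tm k) (x - tm k) = 0 := by
        rcases le_or_gt x 0 with h | h
        · exact cutoff_of_nonpos (by linarith [hpos k hk])
        · exact cutoff_of_gt (by linarith [not_le.1 fun h' => hx ⟨h, h'⟩])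
      rw [vanish l hl.le, vanish (l + 1) hl, sub_zero]
  · congr 1
    funext x
    by_cases hx : x ∈ Set.Ioc 0 t
    · rw [Set.indicator_of_mem hx]
      refine Finset.sum_congr rfl fun l hl => ?_
      have hlt := htm l (Finset.mem_range.1 hl)
      rcases lt_or_ge (t - x) (tm l) with h₁ | h₁
      · rw [if_neg fun h => h₁.not_ge h.1, cutoff_of_gt (by linarith),
          cutoff_of_gt (by linarith), sub_zero]
      rcases lt_or_ge (t - x) (tm (l + 1)) with h₂ | h₂
      · rw [if_pos ⟨h₁, h₂⟩, cutoff_of_mem hx.1 (by linarith), cutoff_of_gt (by linarith),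
          sub_zero]
      · rw [if_neg fun h => h₂.not_gt h.2, cutoff_of_mem hx.1 (by linarith),
          cutoff_of_mem hx.1 (by linarith), sub_self]
    · rw [Set.indicator_of_notMem hx]
      refine Finset.sum_eq_zero fun l hl => ?_
      have hl := Finset.mem_range.1 hl
      have vanish (k : ℕ) (hk : k ≤ K) : cutoff (g l) (t - tm k) x = 0 := by
        rcases le_or_gt x 0 with h | h
        · exact cutoff_of_nonpos h
        · exact cutoff_of_gt (by linarith [hpos k hk, not_le.1 fun h' => hx ⟨h, h'⟩])
      rw [vanish l hl.le, vanish (l + 1) hl, sub_zero]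
end

section
/- Let (λ_n)_{n≥1} be a strictly increasing sequence of positive reals with λ_n → ∞, and adopt the setting of the main uniqueness theorem: meshes 0 ≤ t_0 < … < t_K and 0 ≤ t̃_0 < … < t̃_{K̃}, coefficients a_k, ã_k : ℕ → ℂ with ∑_k ∑_n |a_{k,n}| < ∞, ∑_k ∑_n |ã_{k,n}| < ∞, and a_1 ≠ 0, ã_1 ≠ 0. If for every s with Re s > 0 one has ∑_{k=1}^K (e^{−t_{k−1}s} − e^{−t_k s}) ∑_n a_{k,n} λ_n (s + λ_n)^{−1} = ∑_{k=1}^{K̃} (e^{−t̃_{k−1}s} − e^{−t̃_k s}) ∑_n ã_{k,n} λ_n (s + λ_n)^{−1}, then t_0 = t̃_0. -/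
open Filter Topology

lemma norm_mul_ofReal_mul_inv_le (c : ℂ) {μ l : ℝ} (hμ : 0 < μ) (hl : μ ≤ l) {s : ℂ}
    (hs : -μ < s.re) :
    ‖c * (l : ℂ) * (s + (l : ℂ))⁻¹‖ ≤ ‖c‖ * (1 + μ / (s.re + μ)) := by
  have ht : 0 < s.re + μ := by linarith
  have hsl : 0 < s.re + l := by linarith
  have h1 : s.re + l ≤ ‖s + (l : ℂ)‖ := by
    simpa using Complex.re_le_norm (s + (l : ℂ))
  rw [norm_mul, norm_mul, norm_inv, Complex.norm_real, Real.norm_of_nonneg (by linarith), mul_assoc]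
  refine mul_le_mul_of_nonneg_left ?_ (norm_nonneg c)
  rw [← div_eq_mul_inv]
  calc l / ‖s + (l : ℂ)‖ ≤ l / (s.re + l) := by gcongr; linarith
    _ ≤ 1 + μ / (s.re + μ) := by
      rw [div_le_iff₀ hsl]
      have : μ ≤ μ / (s.re + μ) * (s.re + l) := by
        rw [div_mul_eq_mul_div, le_div_iff₀ ht]
        gcongr
      by_cases h : 0 ≤ s.re
      · nlinarith
      · have : μ / (s.re + μ) * (s.re + l) = μ + μ / (s.re + μ) * (l - μ) := by
          field_simp; ring
        have h4 : 1 ≤ μ / (s.re + μ) := by rw [le_div_iff₀ ht]; linarith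
        nlinarith

/-- A Cauchy-type series with absolutely summable coefficients which vanishes on a ray of the
positive reals has vanishing coefficients. -/
lemma eq_zero_of_tsum_mul_inv_eq_zero {lam : ℕ → ℝ} (hpos : ∀ n, 0 < lam n)
    (hmono : StrictMono lam) {c : ℕ → ℂ} (hc : Summable fun n => ‖c n‖)
    (h0 : ∀ s : ℝ, 1 ≤ s → ∑' n, c n * (lam n : ℂ) * ((s : ℂ) + (lam n : ℂ))⁻¹ = 0) :
    c = 0 := by
  funext m
  induction m using Nat.strong_induction_on with
  | _ m ih =>
  have bound : ∀ n, ∀ s : ℂ, -lam m < s.re →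
      ‖c n * (lam n : ℂ) * (s + (lam n : ℂ))⁻¹‖ ≤ ‖c n‖ * (1 + lam m / (s.re + lam m)) := by
    intro n s hs
    rcases lt_or_ge n m with h | h
    · simp [ih n h]
    · exact norm_mul_ofReal_mul_inv_le _ (hpos m) (hmono.monotone h) hs
  have hdiff : DifferentiableOn ℂ (fun s : ℂ => ∑' n, c n * (lam n : ℂ) * (s + (lam n : ℂ))⁻¹)
      {s : ℂ | -lam m < s.re} := by
    intro z hz
    have hz' : -lam m < z.re := hz
    set r : ℝ := (z.re - lam m) / 2 with hr
    have hopen : IsOpen {s : ℂ | r < s.re} := isOpen_lt continuous_const Complex.continuous_re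
    have hzr : z ∈ {s : ℂ | r < s.re} := by
      simp only [Set.mem_ofPred_eq, hr]; linarith
    have hrm : 0 < r + lam m := by rw [hr]; linarith
    have : DifferentiableOn ℂ (fun s : ℂ => ∑' n, c n * (lam n : ℂ) * (s + (lam n : ℂ))⁻¹)
        {s : ℂ | r < s.re} := by
      refine Complex.differentiableOn_tsum_of_summable_norm
        (u := fun n => ‖c n‖ * (1 + lam m / (r + lam m))) (hc.mul_right _) ?_ hopen ?_
      · intro n s hs
        have hs' : r < s.re := hs
        rcases lt_or_ge n m with h | h
        · simp only [ih n h, Pi.zero_apply, zero_mul]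
          exact differentiableWithinAt_const _
        · have hne : s + (lam n : ℂ) ≠ 0 := by
            intro h'
            have := congrArg Complex.re h'
            have := hmono.monotone h
            simp at *
            linarith
          have hd : DifferentiableAt ℂ (fun z : ℂ => z + (lam n : ℂ)) s :=
            differentiableAt_fun_id.add_const _
          exact ((hd.fun_inv hne).const_mul _).differentiableWithinAt
      · intro n s hs
        have hs' : r < s.re := hs
        have := hpos m
        refine (bound n s (by linarith)).trans ?_
        gcongr
    exact (this.differentiableAt (hopen.mem_nhds hzr)).differentiableWithinAt
  have hopen : IsOpen {s : ℂ | -lam m < s.re} :=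
    isOpen_lt continuous_const Complex.continuous_re
  have hfreq : ∃ᶠ z in 𝓝[≠] (2 : ℂ),
      ∑' n, c n * (lam n : ℂ) * (z + (lam n : ℂ))⁻¹ = 0 := by
    have ht : Tendsto (fun x : ℝ => (x : ℂ)) (𝓝[>] (2 : ℝ)) (𝓝[≠] (2 : ℂ)) := by
      refine tendsto_nhdsWithin_iff.2 ⟨?_, ?_⟩
      · have := (Complex.continuous_ofReal.tendsto (2 : ℝ)).mono_left
          (nhdsWithin_le_nhds (s := Set.Ioi 2))
        simpa using this
      · filter_upwards [self_mem_nhdsWithin] with x hx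
        have hx' : (2 : ℝ) < x := hx
        simp only [Set.mem_compl_iff, Set.mem_singleton_iff]
        exact_mod_cast hx'.ne'
    refine ht.frequently (Eventually.frequently ?_)
    filter_upwards [self_mem_nhdsWithin] with x hx
    have hx' : (2 : ℝ) < x := hx
    exact h0 x (by linarith)
  have hzero := (hdiff.analyticOnNhd hopen).eqOn_zero_of_preconnected_of_frequently_eq_zero
    (convex_halfSpace_re_gt (-lam m)).isPreconnected
    (show (2 : ℂ) ∈ {s : ℂ | -lam m < s.re} by
      have := hpos m
      simp only [Set.mem_ofPred_eq, Complex.re_ofNat]; linarith) hfreq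
  have hlim : Tendsto (fun t : ℝ => ∑' n, (t : ℂ) *
      (c n * (lam n : ℂ) * (((t - lam m : ℝ) : ℂ) + (lam n : ℂ))⁻¹)) (𝓝[>] 0)
      (𝓝 (∑' n, if n = m then c m * (lam m : ℂ) else 0)) := by
    refine tendsto_tsum_of_dominated_convergence (bound := fun n => ‖c n‖ * (1 + lam m))
      (hc.mul_right _) ?_ ?_
    · intro n
      rcases lt_trichotomy n m with h | h | h
      · simp [ih n h, h.ne]
      · subst h
        simp only [if_true]
        refine tendsto_const_nhds.congr' ?_
        filter_upwards [self_mem_nhdsWithin] with t ht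
        have ht' : (t : ℂ) ≠ 0 := by exact_mod_cast (show (0 : ℝ) < t from ht).ne'
        push_cast
        rw [sub_add_cancel]
        field_simp
      · have hlt := hmono h
        have hne : (((0 : ℝ) - lam m : ℝ) : ℂ) + (lam n : ℂ) ≠ 0 := by
          rw [← Complex.ofReal_add]
          exact_mod_cast (show (0 : ℝ) < 0 - lam m + lam n by linarith).ne'
        have hcont : ContinuousAt (fun t : ℝ => (t : ℂ) *
            (c n * (lam n : ℂ) * (((t - lam m : ℝ) : ℂ) + (lam n : ℂ))⁻¹)) 0 := by
          refine Complex.continuous_ofReal.continuousAt.mul (continuousAt_const.mul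
            (ContinuousAt.inv₀ ?_ hne))
          exact ((Complex.continuous_ofReal.comp (continuous_id.sub continuous_const)).add
            continuous_const).continuousAt
        have := hcont.tendsto.mono_left (nhdsWithin_le_nhds (s := Set.Ioi 0))
        simpa [h.ne'] using this
    · filter_upwards [Ioo_mem_nhdsGT (show (0 : ℝ) < 1 by norm_num)] with t ht n
      have hb := bound n ((t - lam m : ℝ) : ℂ) (by simpa using ht.1)
      rw [Complex.ofReal_re, sub_add_cancel] at hb
      rw [norm_mul, Complex.norm_real, Real.norm_of_nonneg ht.1.le]
      calc t * _ ≤ t * (‖c n‖ * (1 + lam m / t)) := mul_le_mul_of_nonneg_left hb ht.1.le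
        _ = ‖c n‖ * (t + lam m) := by have := ht.1.ne'; field_simp
        _ ≤ ‖c n‖ * (1 + lam m) := by
          have := ht.2.le
          gcongr
  have hlim0 : Tendsto (fun t : ℝ => ∑' n, (t : ℂ) *
      (c n * (lam n : ℂ) * (((t - lam m : ℝ) : ℂ) + (lam n : ℂ))⁻¹)) (𝓝[>] 0) (𝓝 0) := by
    refine tendsto_const_nhds.congr' ?_
    filter_upwards [self_mem_nhdsWithin] with t ht
    have ht' : (0 : ℝ) < t := ht
    have := hzero (show ((t - lam m : ℝ) : ℂ) ∈ {s : ℂ | -lam m < s.re} by simpa using ht')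
    rw [tsum_mul_left]
    simp only [Pi.zero_apply] at this
    rw [this, mul_zero]
  have h := tendsto_nhds_unique hlim hlim0
  rw [tsum_ite_eq] at h
  have hne : (lam m : ℂ) ≠ 0 := by exact_mod_cast (hpos m).ne'
  simpa [hne] using h

/-- The principal branch of `w ↦ (w + 1) ^ (1 / 2)`. -/
noncomputable def sqrtAddOne (w : ℂ) : ℂ := Complex.exp (Complex.log (w + 1) / 2)

lemma abs_im_sqrtAddOne_le {w : ℂ} (hw : -1 < w.re) :
    |(sqrtAddOne w).im| ≤ (sqrtAddOne w).re := by
  have hw1 : 0 < (w + 1).re := by simp; linarith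
  have hne : w + 1 ≠ 0 := fun h => by simp [h] at hw1
  have hsq : sqrtAddOne w ^ 2 = w + 1 := by
    rw [sqrtAddOne, ← Complex.exp_nat_mul]
    push_cast
    rw [mul_div_cancel₀ _ (two_ne_zero), Complex.exp_log hne]
  have hre : 0 ≤ (sqrtAddOne w).re := by
    rw [sqrtAddOne, Complex.exp_re]
    refine mul_nonneg (Real.exp_pos _).le (Real.cos_nonneg_of_mem_Icc ?_)
    have h1 := Complex.neg_pi_lt_log_im (w + 1)
    have h2 := Complex.log_im_le_pi (w + 1)
    have : (Complex.log (w + 1) / 2).im = (Complex.log (w + 1)).im / 2 := by simp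
    rw [this]
    constructor <;> linarith
  rw [← hsq, pow_two, Complex.mul_re] at hw1
  exact abs_le_of_sq_le_sq (by nlinarith) hre

lemma half_le_norm_cube_add {u : ℂ} (hu : |u.im| ≤ u.re) (l : ℝ) :
    l / 2 ≤ ‖u ^ 3 + (l : ℂ)‖ := by
  have hre : (u ^ 3 + (l : ℂ)).re = u.re ^ 3 - 3 * u.re * u.im ^ 2 + l := by
    simp [pow_succ]; ring
  have him : (u ^ 3 + (l : ℂ)).im = 3 * u.re ^ 2 * u.im - u.im ^ 3 := by
    simp [pow_succ]; ring
  have h1 := Complex.re_le_norm (u ^ 3 + (l : ℂ))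
  have h2 := Complex.abs_im_le_norm (u ^ 3 + (l : ℂ))
  have h3 := neg_abs_le (u ^ 3 + (l : ℂ)).im
  have h4 := le_abs_self (u ^ 3 + (l : ℂ)).im
  rw [hre] at h1
  rw [him] at h2 h3 h4
  obtain ⟨hy1, hy2⟩ := abs_le.1 hu
  have key1 : 0 ≤ (u.re - u.im) * (u.re ^ 2 + 4 * u.re * u.im + u.im ^ 2) ∨ u.im ≤ 0 := by
    rcases le_total u.im 0 with h | h
    · exact Or.inr h
    · have : 0 ≤ u.re := by linarith
      exact Or.inl (mul_nonneg (by linarith) (by positivity))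
  rcases key1 with h | h
  · nlinarith
  · have hx : 0 ≤ u.re := by linarith
    have : 0 ≤ (u.re + u.im) * (u.re ^ 2 + 4 * u.re * (-u.im) + u.im ^ 2) :=
      mul_nonneg (by linarith)
        (by nlinarith [mul_nonneg hx (neg_nonneg.2 h), sq_nonneg u.re, sq_nonneg u.im])
    nlinarith

lemma sqrtAddOne_ofReal {x : ℝ} (hx : -1 < x) :
    sqrtAddOne (x : ℂ) = (√(x + 1) : ℝ) := by
  have hx1 : 0 < x + 1 := by linarith
  rw [sqrtAddOne, show (x : ℂ) + 1 = ((x + 1 : ℝ) : ℂ) by push_cast; rfl,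
    ← Complex.ofReal_log hx1.le, Real.sqrt_eq_rpow, Real.rpow_def_of_pos hx1]
  push_cast
  congr 1
  ring

/-- Exponential decay along the positive reals forces the coefficients of a Cauchy-type series to
vanish: composing with `w ↦ (w + 1) ^ (3 / 2)` makes the decay superexponential while keeping the
series bounded on the right half-plane. -/
lemma eq_zero_of_tsum_mul_inv_isBigO_exp {lam : ℕ → ℝ} (hpos : ∀ n, 0 < lam n)
    (hmono : StrictMono lam) {c : ℕ → ℂ} (hc : Summable fun n => ‖c n‖) {δ : ℝ} (hδ : 0 < δ)
    (hO : (fun s : ℝ => ∑' n, c n * (lam n : ℂ) * ((s : ℂ) + (lam n : ℂ))⁻¹)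
      =O[atTop] fun s : ℝ => Real.exp (-(δ * s))) :
    c = 0 := by
  set f : ℂ → ℂ := fun w => ∑' n, c n * (lam n : ℂ) * (sqrtAddOne w ^ 3 + (lam n : ℂ))⁻¹ with hf
  have hbound : ∀ n, ∀ w : ℂ, -1 < w.re →
      ‖c n * (lam n : ℂ) * (sqrtAddOne w ^ 3 + (lam n : ℂ))⁻¹‖ ≤ ‖c n‖ * 2 := by
    intro n w hw
    have h := half_le_norm_cube_add (abs_im_sqrtAddOne_le hw) (lam n)
    have hl := hpos n
    rw [norm_mul, norm_mul, norm_inv, Complex.norm_real, Real.norm_of_nonneg hl.le, mul_assoc]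
    refine mul_le_mul_of_nonneg_left ?_ (norm_nonneg _)
    rw [← div_eq_mul_inv, div_le_iff₀ (by linarith)]
    linarith
  have hfb : ∀ w : ℂ, -1 < w.re → ‖f w‖ ≤ ∑' n, ‖c n‖ * 2 := fun w hw =>
    tsum_of_norm_bounded (hc.mul_right 2).hasSum fun n => hbound n w hw
  have hopen : IsOpen {w : ℂ | -1 < w.re} := isOpen_lt continuous_const Complex.continuous_re
  have hdiff : DifferentiableOn ℂ f {w : ℂ | -1 < w.re} := by
    refine Complex.differentiableOn_tsum_of_summable_norm (hc.mul_right 2) ?_ hopen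
      fun n w hw => hbound n w hw
    intro n w hw
    have hw' : -1 < w.re := hw
    have hslit : w + 1 ∈ Complex.slitPlane := Or.inl (by simp; linarith)
    have hne : sqrtAddOne w ^ 3 + (lam n : ℂ) ≠ 0 := by
      have := half_le_norm_cube_add (abs_im_sqrtAddOne_le hw') (lam n)
      have := hpos n
      exact norm_pos_iff.1 (by linarith)
    have hd : DifferentiableAt ℂ sqrtAddOne w :=
      (((differentiableAt_id.add_const 1).clog hslit).div_const 2).cexp
    exact ((((hd.pow 3).add_const _).inv hne).const_mul _).differentiableWithinAt
  have hcl : DiffContOnCl ℂ f {z : ℂ | 0 < z.re} := by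
    refine (hdiff.mono ?_).diffContOnCl
    rw [Complex.closure_setOfPred_lt_re]
    intro z hz
    have : 0 ≤ z.re := hz
    simp only [Set.mem_ofPred_eq]; linarith
  have hreal : ∀ x : ℝ, -1 < x → f x =
      ∑' n, c n * (lam n : ℂ) * (((√(x + 1) ^ 3 : ℝ) : ℂ) + (lam n : ℂ))⁻¹ := by
    intro x hx
    simp only [hf, sqrtAddOne_ofReal hx, Complex.ofReal_pow]
  have hzero : Set.EqOn f 0 {z : ℂ | 0 ≤ z.re} := by
    refine PhragmenLindelof.eq_zero_on_right_half_plane_of_superexponential_decay hcl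
      ⟨1, by norm_num, 0, ?_⟩ ?_ ⟨∑' n, ‖c n‖ * 2, fun x => hfb _ (by simp)⟩
    · refine Asymptotics.IsBigO.of_bound (∑' n, ‖c n‖ * 2) ?_
      filter_upwards [mem_inf_of_right (mem_principal_self _)] with z hz
      have hz' : 0 < z.re := hz
      simpa using hfb z (by linarith)
    · have hsqrt : Tendsto (fun x : ℝ => √(x + 1)) atTop atTop :=
        Real.tendsto_sqrt_atTop.comp (tendsto_atTop_add_const_right _ 1 tendsto_id)
      have hcube : Tendsto (fun x : ℝ => √(x + 1) ^ 3) atTop atTop :=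
        (tendsto_pow_atTop three_ne_zero).comp hsqrt
      obtain ⟨C, hC⟩ := (hO.comp_tendsto hcube).bound
      intro n
      have hexp : Tendsto (fun x : ℝ => |C| * Real.exp (-(x * (δ * √(x + 1) - n)))) atTop (𝓝 0) := by
        have h1 : Tendsto (fun x : ℝ => x * (δ * √(x + 1) - n)) atTop atTop :=
          tendsto_id.atTop_mul_atTop₀
            (tendsto_atTop_add_const_right _ (-(n : ℝ)) (hsqrt.const_mul_atTop hδ))
        simpa using (Real.tendsto_exp_neg_atTop_nhds_zero.comp h1).const_mul |C|
      refine squeeze_zero' (Eventually.of_forall fun x => by positivity) ?_ hexp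
      filter_upwards [hC, eventually_ge_atTop 0] with x hx hx0
      have hb : ‖f x‖ ≤ |C| * Real.exp (-(δ * √(x + 1) ^ 3)) := by
        rw [hreal x (by linarith)]
        refine (hx.trans_eq ?_).trans
          (mul_le_mul_of_nonneg_right (le_abs_self C) (Real.exp_pos _).le)
        simp
      have hsq : √(x + 1) ^ 2 = x + 1 := Real.sq_sqrt (by linarith)
      calc Real.exp x ^ n * ‖f x‖
          ≤ Real.exp x ^ n * (|C| * Real.exp (-(δ * √(x + 1) ^ 3))) := by gcongr
        _ = |C| * Real.exp (n * x + -(δ * √(x + 1) ^ 3)) := by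
          rw [Real.exp_add, Real.exp_nat_mul]; ring
        _ ≤ |C| * Real.exp (-(x * (δ * √(x + 1) - n))) := by
          gcongr
          have : 0 ≤ δ * √(x + 1) := by positivity
          have h3 : √(x + 1) ^ 3 = (x + 1) * √(x + 1) := by rw [pow_succ, hsq]
          rw [h3]
          nlinarith
  refine eq_zero_of_tsum_mul_inv_eq_zero hpos hmono hc fun s hs => ?_
  have hs0 : 0 < s := by linarith
  have hone : 1 ≤ s ^ (2 / 3 : ℝ) := Real.one_le_rpow hs (by norm_num)
  have hx : (0 : ℝ) ≤ s ^ (2 / 3 : ℝ) - 1 := by linarith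
  have h := hzero (show ((s ^ (2 / 3 : ℝ) - 1 : ℝ) : ℂ) ∈ {z : ℂ | 0 ≤ z.re} by
    simpa only [Set.mem_ofPred_eq, Complex.ofReal_re] using hx)
  have hcube : √(s ^ (2 / 3 : ℝ) - 1 + 1) ^ 3 = s := by
    rw [sub_add_cancel, Real.sqrt_eq_rpow, ← Real.rpow_mul hs0.le, ← Real.rpow_mul_natCast hs0.le]
    norm_num
  rw [hreal _ (by linarith), hcube] at h
  exact h

lemma exp_mul_tsum_isBigO {lam : ℕ → ℝ} (hpos : ∀ n, 0 < lam n) {c : ℕ → ℂ}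
    (hc : Summable fun n => ‖c n‖) {T τ : ℝ} (hT : τ ≤ T) :
    (fun s : ℝ => Complex.exp (-(T : ℂ) * s) *
      ∑' n, c n * (lam n : ℂ) * ((s : ℂ) + (lam n : ℂ))⁻¹)
      =O[atTop] fun s : ℝ => Real.exp (-(τ * s)) := by
  refine Asymptotics.IsBigO.of_bound (∑' n, ‖c n‖) ?_
  filter_upwards [eventually_ge_atTop 0] with s hs
  have hexp : ‖Complex.exp (-(T : ℂ) * s)‖ ≤ Real.exp (-(τ * s)) := by
    rw [Complex.norm_exp, ← Complex.ofReal_neg, ← Complex.ofReal_mul, Complex.ofReal_re, neg_mul]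
    gcongr
  have hQ : ‖∑' n, c n * (lam n : ℂ) * ((s : ℂ) + (lam n : ℂ))⁻¹‖ ≤ ∑' n, ‖c n‖ := by
    refine tsum_of_norm_bounded hc.hasSum fun n => ?_
    have hl := hpos n
    rw [mul_assoc, norm_mul]
    refine mul_le_of_le_one_right (norm_nonneg _) ?_
    rw [← Complex.ofReal_add, ← Complex.ofReal_inv, ← Complex.ofReal_mul, Complex.norm_real,
      Real.norm_of_nonneg (by positivity), ← div_eq_mul_inv, div_le_one (by positivity)]
    linarith
  rw [norm_mul, Real.norm_of_nonneg (Real.exp_pos _).le, mul_comm]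
  gcongr

lemma exp_sub_exp_mul_tsum_isBigO {lam : ℕ → ℝ} (hpos : ∀ n, 0 < lam n) {c : ℕ → ℂ}
    (hc : Summable fun n => ‖c n‖) {T T' τ : ℝ} (hT : τ ≤ T) (hT' : τ ≤ T') :
    (fun s : ℝ => (Complex.exp (-(T : ℂ) * s) - Complex.exp (-(T' : ℂ) * s)) *
      ∑' n, c n * (lam n : ℂ) * ((s : ℂ) + (lam n : ℂ))⁻¹)
      =O[atTop] fun s : ℝ => Real.exp (-(τ * s)) := by
  simpa only [sub_mul] using (exp_mul_tsum_isBigO hpos hc hT).sub (exp_mul_tsum_isBigO hpos hc hT')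

lemma apply_le_apply_of_forall_lt_succ {K : ℕ} {t : ℕ → ℝ} (ht : ∀ k < K, t k < t (k + 1))
    {i j : ℕ} (hij : i ≤ j) (hj : j ≤ K) : t i ≤ t j := by
  induction j, hij using Nat.le_induction with
  | base => exact le_rfl
  | succ j _ ih => exact (ih (by omega)).trans (ht j (by omega)).le

lemma start_le_start_of_sum_eq {lam : ℕ → ℝ} (hpos : ∀ n, 0 < lam n) (hmono : StrictMono lam)
    {K K' : ℕ} (hK : 1 ≤ K) {t t' : ℕ → ℝ} (ht : ∀ k < K, t k < t (k + 1))
    (ht' : ∀ k < K', t' k < t' (k + 1)) {a b : ℕ → ℕ → ℂ}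
    (ha : ∀ k < K, Summable fun n => ‖a k n‖) (hb : ∀ k < K', Summable fun n => ‖b k n‖)
    (ha0 : a 0 ≠ 0)
    (heq : ∀ s : ℂ, 0 < s.re →
      ∑ k ∈ Finset.range K,
          (Complex.exp (-(t k : ℂ) * s) - Complex.exp (-(t (k + 1) : ℂ) * s)) *
            ∑' n : ℕ, a k n * (lam n : ℂ) * (s + (lam n : ℂ))⁻¹
        = ∑ k ∈ Finset.range K',
            (Complex.exp (-(t' k : ℂ) * s) - Complex.exp (-(t' (k + 1) : ℂ) * s)) *
              ∑' n : ℕ, b k n * (lam n : ℂ) * (s + (lam n : ℂ))⁻¹) :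
    t' 0 ≤ t 0 := by
  by_contra! hlt
  refine ha0 ?_
  set τ : ℝ := min (t' 0) (t 1) with hτ
  have hτ0 : 0 < τ - t 0 := sub_pos.2 (lt_min hlt (ht 0 (by omega)))
  obtain ⟨N, rfl⟩ : ∃ N, K = N + 1 := ⟨K - 1, by omega⟩
  have htail : (fun s : ℝ => ∑ k ∈ Finset.range N,
      (Complex.exp (-(t (k + 1) : ℂ) * s) - Complex.exp (-(t (k + 1 + 1) : ℂ) * s)) *
        ∑' n : ℕ, a (k + 1) n * (lam n : ℂ) * ((s : ℂ) + (lam n : ℂ))⁻¹)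
      =O[atTop] fun s : ℝ => Real.exp (-(τ * s)) := by
    refine Asymptotics.IsBigO.fun_sum fun k hk => ?_
    have hk' := Finset.mem_range.1 hk
    exact exp_sub_exp_mul_tsum_isBigO hpos (ha _ (by omega))
      ((min_le_right _ _).trans (apply_le_apply_of_forall_lt_succ ht (by omega) (by omega)))
      ((min_le_right _ _).trans (apply_le_apply_of_forall_lt_succ ht (by omega) (by omega)))
  have hright : (fun s : ℝ => ∑ k ∈ Finset.range K',
      (Complex.exp (-(t' k : ℂ) * s) - Complex.exp (-(t' (k + 1) : ℂ) * s)) *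
        ∑' n : ℕ, b k n * (lam n : ℂ) * ((s : ℂ) + (lam n : ℂ))⁻¹)
      =O[atTop] fun s : ℝ => Real.exp (-(τ * s)) := by
    refine Asymptotics.IsBigO.fun_sum fun k hk => ?_
    have hk' := Finset.mem_range.1 hk
    exact exp_sub_exp_mul_tsum_isBigO hpos (hb _ (by omega))
      ((min_le_left _ _).trans (apply_le_apply_of_forall_lt_succ ht' (by omega) (by omega)))
      ((min_le_left _ _).trans (apply_le_apply_of_forall_lt_succ ht' (by omega) (by omega)))
  have hsub : (fun s : ℝ => (Complex.exp (-(t 0 : ℂ) * s) - Complex.exp (-(t 1 : ℂ) * s)) *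
      ∑' n : ℕ, a 0 n * (lam n : ℂ) * ((s : ℂ) + (lam n : ℂ))⁻¹)
      =O[atTop] fun s : ℝ => Real.exp (-(τ * s)) := by
    refine (hright.sub htail).congr' ?_ EventuallyEq.rfl
    filter_upwards [eventually_gt_atTop 0] with s hs
    rw [← heq (s : ℂ) (by simpa using hs), Finset.sum_range_succ']
    simp
  have hfirst : (fun s : ℝ => Complex.exp (-(t 0 : ℂ) * s) *
      ∑' n : ℕ, a 0 n * (lam n : ℂ) * ((s : ℂ) + (lam n : ℂ))⁻¹)
      =O[atTop] fun s : ℝ => Real.exp (-(τ * s)) := by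
    refine (hsub.add (exp_mul_tsum_isBigO hpos (ha 0 (by omega))
      (min_le_right (t' 0) (t 1)))).congr_left fun s => ?_
    ring
  refine eq_zero_of_tsum_mul_inv_isBigO_exp hpos hmono (ha 0 (by omega)) hτ0 ?_
  have hexp : (fun s : ℝ => Complex.exp ((t 0 : ℂ) * s)) =O[atTop]
      fun s : ℝ => Real.exp (t 0 * s) := by
    refine Asymptotics.isBigO_of_le _ fun s => ?_
    rw [← Complex.ofReal_mul, ← Complex.ofReal_exp, Complex.norm_real]
  refine (hexp.mul hfirst).congr (fun s => ?_) fun s => ?_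
  · rw [← mul_assoc, ← Complex.exp_add, neg_mul, add_neg_cancel, Complex.exp_zero, one_mul]
  · rw [← Real.exp_add]
    congr 1
    ring

/-- First step of the proof of Theorem 1.2: determination of the starting time `t₀`. -/
theorem stmt_12 (lam : ℕ → ℝ) (hpos : ∀ n, 0 < lam n)
    (hmono : StrictMono lam) (hlim : Tendsto lam atTop atTop)
    (K K' : ℕ) (hK : 1 ≤ K) (hK' : 1 ≤ K')
    (tm tm' : ℕ → ℝ) (htm0 : 0 ≤ tm 0) (htm'0 : 0 ≤ tm' 0)
    (htm : ∀ k < K, tm k < tm (k + 1)) (htm' : ∀ k < K', tm' k < tm' (k + 1))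
    (a b : ℕ → ℕ → ℂ)
    (ha : ∀ k < K, Summable fun n => ‖a k n‖)
    (hb : ∀ k < K', Summable fun n => ‖b k n‖)
    (ha0 : a 0 ≠ 0) (hb0 : b 0 ≠ 0)
    (heq : ∀ s : ℂ, 0 < s.re →
      ∑ k ∈ Finset.range K,
          (Complex.exp (-(tm k : ℂ) * s) - Complex.exp (-(tm (k + 1) : ℂ) * s)) *
            ∑' n : ℕ, a k n * (lam n : ℂ) * (s + (lam n : ℂ))⁻¹
        = ∑ k ∈ Finset.range K',
            (Complex.exp (-(tm' k : ℂ) * s) - Complex.exp (-(tm' (k + 1) : ℂ) * s)) *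
              ∑' n : ℕ, b k n * (lam n : ℂ) * (s + (lam n : ℂ))⁻¹) :
    tm 0 = tm' 0 := by
  exact le_antisymm
    (start_le_start_of_sum_eq hpos hmono hK' htm' htm hb ha hb0 fun s hs => (heq s hs).symm)
    (start_le_start_of_sum_eq hpos hmono hK htm htm' ha hb ha0 heq)
end

section
/- Let (λ_n)_{n≥1} be a strictly increasing sequence of positive reals with λ_n → ∞, let 0 ≤ t_0 < t_1 < … < t_K be a finite mesh, and for 1 ≤ k ≤ K let a_k : ℕ → ℂ satisfy ∑_{k=1}^K ∑_{n=1}^∞ |a_{k,n}| < ∞. If ∑_{k=1}^K (e^{−t_{k−1}s} − e^{−t_k s}) ∑_{n=1}^∞ a_{k,n} λ_n (s + λ_n)^{−1} = 0 for every s ∈ ℂ with Re s > 0, then a_{k,n} = 0 for all 1 ≤ k ≤ K and all n. -/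
open Filter Topology

open MeasureTheory

lemma norm_one_sub_exp_neg_le {x : ℝ} (hx : 0 ≤ x) : ‖1 - Complex.exp (-(x : ℂ))‖ ≤ 1 := by
  rw [← Complex.ofReal_neg, ← Complex.ofReal_exp, ← Complex.ofReal_one, ← Complex.ofReal_sub,
    Complex.norm_real, Real.norm_eq_abs, abs_le]
  have h₁ := Real.exp_pos (-x)
  have h₂ : Real.exp (-x) ≤ 1 := Real.exp_le_one_iff.2 (by linarith)
  constructor <;> linarith

/-- The primitive, vanishing on `(-∞, 0]`, of the exponential series
`∑ bₙ λₙ e^{-λₙ t}` on `(0, ∞)`. -/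
noncomputable def expRamp (lam : ℕ → ℝ) (b : ℕ → ℂ) (t : ℝ) : ℂ :=
  ∑' n, b n * (1 - Complex.exp (-((lam n * max t 0 : ℝ) : ℂ)))

section expRamp

variable {lam : ℕ → ℝ} {b : ℕ → ℂ}

lemma norm_expRamp_term_le (hpos : ∀ n, 0 < lam n) (n : ℕ) (t : ℝ) :
    ‖b n * (1 - Complex.exp (-((lam n * max t 0 : ℝ) : ℂ)))‖ ≤ ‖b n‖ := by
  rw [norm_mul]
  exact mul_le_of_le_one_right (norm_nonneg _)
    (norm_one_sub_exp_neg_le (mul_nonneg (hpos n).le (le_max_right _ _)))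

lemma continuous_expRamp (hpos : ∀ n, 0 < lam n) (hb : Summable fun n => ‖b n‖) :
    Continuous (expRamp lam b) := by
  unfold expRamp
  refine continuous_tsum (fun n => ?_) hb (norm_expRamp_term_le hpos)
  fun_prop

lemma expRamp_of_nonpos {t : ℝ} (ht : t ≤ 0) : expRamp lam b t = 0 := by
  simp [expRamp, max_eq_right ht]

lemma norm_expRamp_le (hpos : ∀ n, 0 < lam n) (hb : Summable fun n => ‖b n‖) (t : ℝ) :
    ‖expRamp lam b t‖ ≤ ∑' n, ‖b n‖ :=
  tsum_of_norm_bounded hb.hasSum fun n => norm_expRamp_term_le hpos n t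

lemma integrable_expRamp_mul_exp (hpos : ∀ n, 0 < lam n) (hb : Summable fun n => ‖b n‖)
    {s : ℂ} (hs : 0 < s.re) :
    Integrable fun t : ℝ => expRamp lam b t * Complex.exp (-s * t) := by
  rw [← integrableOn_iff_integrable_of_support_subset (s := Set.Ioi 0)]
  · exact (integrableOn_exp_mul_complex_Ioi (a := -s) (by simpa using hs) 0).bdd_mul
      (continuous_expRamp hpos hb).aestronglyMeasurable
      (Eventually.of_forall (norm_expRamp_le hpos hb))
  · intro t ht
    by_contra h
    exact ht (by simp [expRamp_of_nonpos (not_lt.1 h)])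

lemma integral_expRamp_mul_exp (hpos : ∀ n, 0 < lam n) (hb : Summable fun n => ‖b n‖)
    {s : ℂ} (hs : 0 < s.re) :
    ∫ t : ℝ, expRamp lam b t * Complex.exp (-s * t) =
      s⁻¹ * ∑' n, b n * (lam n : ℂ) * (s + (lam n : ℂ))⁻¹ := by
  have hs0 : s ≠ 0 := by rintro rfl; simp at hs
  have hre : (-s).re < 0 := by simpa using hs
  have hint := integrableOn_exp_mul_complex_Ioi hre 0
  set F : ℕ → ℝ → ℂ := fun n t =>
    b n * (1 - Complex.exp (-((lam n * max t 0 : ℝ) : ℂ))) * Complex.exp (-s * t) with hF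
  have hFint (n : ℕ) : Integrable (F n) (volume.restrict (Set.Ioi 0)) := by
    refine hint.bdd_mul (c := ‖b n‖) ?_ (Eventually.of_forall (norm_expRamp_term_le hpos n))
    exact Continuous.aestronglyMeasurable (by fun_prop)
  have hval (n : ℕ) : ∫ t in Set.Ioi (0 : ℝ), F n t =
      s⁻¹ * (b n * (lam n : ℂ) * (s + (lam n : ℂ))⁻¹) := by
    have hre' : (-(s + lam n)).re < 0 := by
      have := hpos n
      simp only [Complex.neg_re, Complex.add_re, Complex.ofReal_re]
      linarith
    have hne : s + lam n ≠ 0 := by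
      intro h
      simp [h] at hre'
    have hcongr : ∫ t in Set.Ioi (0 : ℝ), F n t = ∫ t in Set.Ioi (0 : ℝ),
        b n * (Complex.exp (-s * t) - Complex.exp (-(s + lam n) * t)) := by
      refine setIntegral_congr_fun measurableSet_Ioi fun t ht => ?_
      simp only [hF, max_eq_left (le_of_lt (Set.mem_Ioi.1 ht))]
      rw [mul_assoc, sub_mul, one_mul, ← Complex.exp_add]
      congr 3
      push_cast
      ring_nf
    rw [hcongr, integral_const_mul, integral_sub hint (integrableOn_exp_mul_complex_Ioi hre' 0),
      integral_exp_mul_complex_Ioi hre, integral_exp_mul_complex_Ioi hre']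
    simp only [Complex.ofReal_zero, mul_zero, Complex.exp_zero]
    field_simp
    ring
  have hsum : Summable fun n => ∫ t in Set.Ioi (0 : ℝ), ‖F n t‖ := by
    refine Summable.of_nonneg_of_le (fun n => integral_nonneg fun t => norm_nonneg _) (fun n => ?_)
      (hb.mul_right (∫ t in Set.Ioi (0 : ℝ), ‖Complex.exp (-s * t)‖))
    rw [← integral_const_mul]
    refine integral_mono (hFint n).norm (hint.norm.const_mul _) fun t => ?_
    simp only [hF]
    rw [norm_mul]
    exact mul_le_mul_of_nonneg_right (norm_expRamp_term_le hpos n t) (norm_nonneg _)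
  have key := (hasSum_integral_of_summable_integral_norm hFint hsum).tsum_eq
  simp only [hval, tsum_mul_left] at key
  rw [key, ← setIntegral_eq_integral_of_forall_compl_eq_zero (s := Set.Ioi 0)]
  · simp only [hF, expRamp, tsum_mul_right]
  · intro t ht
    simp [expRamp_of_nonpos (not_lt.1 ht)]

lemma expRamp_sub_mul_exp (c : ℝ) (s : ℂ) (t : ℝ) :
    expRamp lam b (t - c) * Complex.exp (-s * t) = Complex.exp (-(c : ℂ) * s) *
      (expRamp lam b (t - c) * Complex.exp (-s * (t - c : ℝ))) := by
  rw [mul_left_comm, ← Complex.exp_add]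
  congr 2
  push_cast
  ring

lemma integrable_expRamp_sub_mul_exp (hpos : ∀ n, 0 < lam n) (hb : Summable fun n => ‖b n‖)
    {s : ℂ} (hs : 0 < s.re) (c : ℝ) :
    Integrable fun t : ℝ => expRamp lam b (t - c) * Complex.exp (-s * t) := by
  simp only [expRamp_sub_mul_exp c s]
  exact ((integrable_expRamp_mul_exp hpos hb hs).comp_sub_right c).const_mul _

lemma integral_expRamp_sub_mul_exp (hpos : ∀ n, 0 < lam n) (hb : Summable fun n => ‖b n‖)
    {s : ℂ} (hs : 0 < s.re) (c : ℝ) :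
    ∫ t : ℝ, expRamp lam b (t - c) * Complex.exp (-s * t) = Complex.exp (-(c : ℂ) * s) *
      (s⁻¹ * ∑' n, b n * (lam n : ℂ) * (s + (lam n : ℂ))⁻¹) := by
  simp only [expRamp_sub_mul_exp c s]
  rw [integral_const_mul,
    integral_sub_right_eq_self (fun t : ℝ => expRamp lam b t * Complex.exp (-s * t)) c,
    integral_expRamp_mul_exp hpos hb hs]

end expRamp

/-- Uniqueness for the two-sided Laplace transform of a continuous function on the line
`Re s = σ`. -/
lemma eq_zero_of_forall_integral_mul_exp_eq_zero {g : ℝ → ℂ} (σ : ℝ) (hg : Continuous g)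
    (hint : Integrable fun t : ℝ => g t * Complex.exp (-(σ : ℂ) * t))
    (h : ∀ s : ℂ, s.re = σ → ∫ t : ℝ, g t * Complex.exp (-s * t) = 0) : g = 0 := by
  have hF : FourierTransform.fourier (fun t : ℝ => g t * Complex.exp (-(σ : ℂ) * t)) = 0 := by
    funext w
    rw [Real.fourier_real_eq_integral_exp_smul, Pi.zero_apply,
      ← h (σ + 2 * Real.pi * w * Complex.I) (by simp)]
    congr 1 with t
    rw [smul_eq_mul, mul_left_comm, ← Complex.exp_add]
    congr 2
    push_cast
    ring
  have hinv := Continuous.fourierInv_fourier_eq (by fun_prop) hint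
    (by rw [hF]; exact integrable_zero _ _ _)
  rw [hF] at hinv
  funext t
  have ht := congrFun hinv t
  rw [Real.fourierInv_eq] at ht
  simpa using ht.symm

/-- The coefficients of an absolutely convergent exponential series are determined by its values
on `(0, ∞)`. -/
lemma eq_zero_of_tsum_mul_exp_eq_zero {lam : ℕ → ℝ} (hmono : StrictMono lam) {b : ℕ → ℂ}
    (hb : Summable fun n => ‖b n‖)
    (h : ∀ t : ℝ, 0 < t → ∑' n, b n * Complex.exp (-((lam n * t : ℝ) : ℂ)) = 0) (n : ℕ) :
    b n = 0 := by
  induction n using Nat.strong_induction_on with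
  | _ n ih =>
    have hlim : Tendsto (fun t : ℝ => ∑' m, b m * Complex.exp (-(((lam m - lam n) * t : ℝ) : ℂ)))
        atTop (𝓝 (∑' m, if m = n then b n else 0)) := by
      refine tendsto_tsum_of_dominated_convergence hb (fun m => ?_) ?_
      · rcases lt_trichotomy m n with hm | rfl | hm
        · simp [ih m hm, hm.ne]
        · simp
        · rw [if_neg hm.ne']
          have : Tendsto (fun t : ℝ => Complex.exp (-(((lam m - lam n) * t : ℝ) : ℂ)))
              atTop (𝓝 0) := by
            rw [Complex.tendsto_exp_nhds_zero_iff]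
            simp only [Complex.neg_re, Complex.ofReal_re]
            exact tendsto_neg_atTop_atBot.comp
              (tendsto_id.const_mul_atTop (sub_pos.2 (hmono hm)))
          simpa using this.const_mul (b m)
      · filter_upwards [eventually_ge_atTop 0] with t ht m
        rcases lt_or_ge m n with hm | hm
        · simp [ih m hm]
        · rw [norm_mul, Complex.norm_exp]
          refine mul_le_of_le_one_right (norm_nonneg _) (Real.exp_le_one_iff.2 ?_)
          simpa using mul_nonneg (sub_nonneg.2 (hmono.monotone hm)) ht
    rw [tsum_ite_eq] at hlim
    refine tendsto_nhds_unique hlim (tendsto_const_nhds.congr' ?_)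
    filter_upwards [eventually_gt_atTop 0] with t ht
    have hmul := congrArg (· * Complex.exp ((lam n * t : ℝ) : ℂ)) (h t ht)
    simp only [zero_mul, ← tsum_mul_right] at hmul
    rw [← hmul]
    refine tsum_congr fun m => ?_
    rw [mul_assoc, ← Complex.exp_add]
    congr 2
    push_cast
    ring

lemma eq_zero_of_expRamp_eq_zero {lam : ℕ → ℝ} (hpos : ∀ n, 0 < lam n) (hmono : StrictMono lam)
    {b : ℕ → ℂ} (hb : Summable fun n => ‖b n‖) {δ : ℝ} (hδ : 0 < δ)
    (h : ∀ t, 0 < t → t < δ → expRamp lam b t = 0) (n : ℕ) : b n = 0 := by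
  set U : Set ℂ := {z | 0 < z.re} with hU
  have hUo : IsOpen U := isOpen_lt continuous_const Complex.continuous_re
  have hdiff : DifferentiableOn ℂ
      (fun z : ℂ => ∑' n, b n * (1 - Complex.exp (-(lam n * z)))) U := by
    refine Complex.differentiableOn_tsum_of_summable_norm (hb.mul_right 2) (fun n => ?_) hUo ?_
    · exact Differentiable.differentiableOn (by fun_prop)
    · intro n z hz
      rw [norm_mul]
      refine mul_le_mul_of_nonneg_left ((norm_sub_le _ _).trans ?_) (norm_nonneg _)
      have : ‖Complex.exp (-(lam n * z))‖ ≤ 1 := by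
        rw [Complex.norm_exp, Real.exp_le_one_iff]
        simpa using mul_nonneg (hpos n).le (le_of_lt hz)
      rw [norm_one]
      linarith
  have hramp (t : ℝ) (ht : 0 < t) :
      expRamp lam b t = ∑' n, b n * (1 - Complex.exp (-(lam n * (t : ℂ)))) := by
    simp [expRamp, max_eq_left ht.le]
  have hzero (t : ℝ) (ht : 0 < t) : expRamp lam b t = 0 := by
    rw [hramp t ht]
    refine (hdiff.analyticOnNhd hUo).eqOn_of_preconnected_of_frequently_eq
      (g := fun _ => 0) (z₀ := ((δ / 2 : ℝ) : ℂ)) analyticOnNhd_const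
      (convex_halfSpace_re_gt 0).isPreconnected ?_ ?_ (show (t : ℂ) ∈ U by simpa [hU] using ht)
    · simpa [hU] using hδ
    · have hev : ∀ᶠ t : ℝ in 𝓝[≠] (δ / 2),
          ∑' n, b n * (1 - Complex.exp (-(lam n * (t : ℂ)))) = 0 := by
        filter_upwards [nhdsWithin_le_nhds (Ioo_mem_nhds (half_pos hδ) (half_lt_self hδ))]
          with t ht
        rw [← hramp t ht.1, h t ht.1 ht.2]
      refine Tendsto.frequently (tendsto_nhdsWithin_iff.2 ⟨?_, ?_⟩) hev.frequently
      · exact (Complex.continuous_ofReal.tendsto _).mono_left nhdsWithin_le_nhds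
      · filter_upwards [self_mem_nhdsWithin] with t ht
        simpa only [Set.mem_compl_iff, Set.mem_singleton_iff, Complex.ofReal_inj] using ht
  have hbsum : Summable b := hb.of_norm
  have hnorm (n : ℕ) (t : ℝ) (ht : 0 < t) :
      ‖b n * Complex.exp (-((lam n * t : ℝ) : ℂ))‖ ≤ ‖b n‖ := by
    rw [norm_mul, Complex.norm_exp]
    refine mul_le_of_le_one_right (norm_nonneg _) (Real.exp_le_one_iff.2 ?_)
    simpa using (mul_pos (hpos n) ht).le
  have hsplit (t : ℝ) (ht : 0 < t) :
      ∑' n, b n * Complex.exp (-((lam n * t : ℝ) : ℂ)) = ∑' n, b n := by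
    have h0 := hzero t ht
    simp only [expRamp, max_eq_left ht.le, mul_sub, mul_one] at h0
    rw [hbsum.tsum_sub (hb.of_norm_bounded fun n => hnorm n t ht)] at h0
    exact (sub_eq_zero.1 h0).symm
  have hb0 : ∑' n, b n = 0 := by
    have hlim : Tendsto (fun t : ℝ => ∑' n, b n * Complex.exp (-((lam n * t : ℝ) : ℂ)))
        atTop (𝓝 (∑' _ : ℕ, (0 : ℂ))) := by
      refine tendsto_tsum_of_dominated_convergence hb (fun n => ?_) ?_
      · have : Tendsto (fun t : ℝ => Complex.exp (-((lam n * t : ℝ) : ℂ))) atTop (𝓝 0) := by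
          rw [Complex.tendsto_exp_nhds_zero_iff]
          simp only [Complex.neg_re, Complex.ofReal_re]
          exact tendsto_neg_atTop_atBot.comp (tendsto_id.const_mul_atTop (hpos n))
        simpa using this.const_mul (b n)
      · filter_upwards [eventually_gt_atTop 0] with t ht n using hnorm n t ht
    rw [tsum_zero] at hlim
    refine tendsto_nhds_unique (tendsto_const_nhds.congr' ?_) hlim
    filter_upwards [eventually_gt_atTop 0] with t ht using (hsplit t ht).symm
  exact eq_zero_of_tsum_mul_exp_eq_zero hmono hb (fun t ht => (hsplit t ht).trans hb0) n

open Filter Topology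

/-- Vanishing lemma (final step in the proof of Theorem 1.2): if
`∑ₖ (e^{-t_{k-1}s} - e^{-t_k s}) ∑ₙ a_{k,n} λₙ (s+λₙ)⁻¹ = 0` for all `Re s > 0`,
then all coefficients `a_{k,n}` vanish. -/
theorem stmt_16 (lam : ℕ → ℝ) (hpos : ∀ n, 0 < lam n)
    (hmono : StrictMono lam) (hlim : Tendsto lam atTop atTop)
    (K : ℕ) (hK : 1 ≤ K) (tm : ℕ → ℝ)
    (htm0 : 0 ≤ tm 0) (htm : ∀ k < K, tm k < tm (k + 1))
    (a : ℕ → ℕ → ℂ) (ha : ∀ k < K, Summable fun n => ‖a k n‖)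
    (heq : ∀ s : ℂ, 0 < s.re →
      ∑ k ∈ Finset.range K,
          (Complex.exp (-(tm k : ℂ) * s) - Complex.exp (-(tm (k + 1) : ℂ) * s)) *
            ∑' n : ℕ, a k n * (lam n : ℂ) * (s + (lam n : ℂ))⁻¹ = 0) :
    ∀ k < K, ∀ n, a k n = 0 := by
  have hle : ∀ i j, i ≤ j → j ≤ K → tm i ≤ tm j := by
    intro i j hij
    induction j, hij using Nat.le_induction with
    | base => exact fun _ => le_rfl
    | succ j _ ih => exact fun hj => (ih (by omega)).trans (htm j (by omega)).le
  set g : ℝ → ℂ := fun t => ∑ k ∈ Finset.range K,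
    (expRamp lam (a k) (t - tm k) - expRamp lam (a k) (t - tm (k + 1))) with hg
  have hgmul (s : ℂ) (t : ℝ) : g t * Complex.exp (-s * t) = ∑ k ∈ Finset.range K,
      (expRamp lam (a k) (t - tm k) * Complex.exp (-s * t) -
        expRamp lam (a k) (t - tm (k + 1)) * Complex.exp (-s * t)) := by
    simp only [hg, Finset.sum_mul, sub_mul]
  have hint {s : ℂ} (hs : 0 < s.re) {k : ℕ} (hk : k ∈ Finset.range K) (c : ℝ) :=
    integrable_expRamp_sub_mul_exp hpos (ha k (Finset.mem_range.1 hk)) hs c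
  have hg0 : g = 0 := by
    refine eq_zero_of_forall_integral_mul_exp_eq_zero 1 ?_ ?_ fun s hs => ?_
    · refine continuous_finsetSum _ fun k hk => ?_
      have := continuous_expRamp hpos (ha k (Finset.mem_range.1 hk))
      fun_prop
    · simp only [hgmul]
      exact integrable_finsetSum _ fun k hk => (hint (by simp) hk _).sub (hint (by simp) hk _)
    · have hs' : 0 < s.re := by rw [hs]; exact one_pos
      simp only [hgmul]
      refine (integral_finsetSum _ fun k hk => (hint hs' hk _).sub (hint hs' hk _)).trans ?_
      simp only [Pi.sub_apply]
      rw [← mul_zero s⁻¹, ← heq s hs', Finset.mul_sum]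
      refine Finset.sum_congr rfl fun k hk => ?_
      have hb := ha k (Finset.mem_range.1 hk)
      rw [integral_sub (hint hs' hk _) (hint hs' hk _), integral_expRamp_sub_mul_exp hpos hb hs',
        integral_expRamp_sub_mul_exp hpos hb hs']
      ring
  intro k
  induction k using Nat.strong_induction_on with
  | _ k ih =>
    intro hk
    refine eq_zero_of_expRamp_eq_zero hpos hmono (ha k hk) (sub_pos.2 (htm k hk)) fun t ht₀ ht₁ => ?_
    have hgt := congrFun hg0 (t + tm k)
    simp only [hg, Pi.zero_apply] at hgt
    rw [Finset.sum_eq_single k] at hgt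
    · rwa [add_sub_cancel_right, expRamp_of_nonpos (t := t + tm k - tm (k + 1)) (by linarith),
        sub_zero] at hgt
    · intro j hj hjk
      have hj := Finset.mem_range.1 hj
      rcases lt_or_gt_of_ne hjk with hlt | hgt
      · simp [expRamp, ih j hlt hj]
      · have h₁ := hle (k + 1) j hgt hj.le
        have h₂ := htm j hj
        rw [expRamp_of_nonpos (by linarith), expRamp_of_nonpos (by linarith), sub_zero]
    · exact fun h => absurd (Finset.mem_range.2 hk) h
end
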